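/- arXiv:0901.0253 — 4 statements merged into one kernel-verified Lean document; each statement's English description precedes it below -/
import Mathlib

section
/- Let A be an essential central arrangement of rank 2 consisting of d ≥ 4 hyperplanes, with Orlik–Terao ideal I ⊆ R = K[y_1,…,y_d]. Then the projective variety V(I) ⊆ P^{d−1} is a rational normal curve of degree d−1; in particular it is a smooth, irreducible, nondegenerate curve of degree d−1, and dim T_p(V(I)) = 1 at every point p of V(I). -/
open MvPolynomial

/-- An essential central arrangement of hyperplanes in `K^n`, with hyperplanes indexed by `ι`:
the hyperplane `H i` is the kernel of the nonzero linear form with coefficient vector `form i`,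
the forms are pairwise non-proportional (the hyperplanes are distinct), and they span the dual
space (the arrangement is essential, i.e. has rank `n`). -/
structure CentralArrangement (K : Type*) [Field K] (ι : Type*) [Fintype ι] (n : ℕ) where
  form : ι → (Fin n → K)
  nonzero : ∀ i, form i ≠ 0
  nonProportional : ∀ i j, i ≠ j → ∀ t : K, form i ≠ t • form j
  essential : Submodule.span K (Set.range form) = ⊤

namespace CentralArrangement

variable {K : Type*} [Field K] {ι : Type*} [Fintype ι] {n : ℕ}

/-- The evaluation map `K^ι → K[x_1,…,x_n]_1 ≅ K^n`, sending `e i` to the form `α i`. -/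
noncomputable def evalMap (A : CentralArrangement K ι n) : (ι → K) →ₗ[K] (Fin n → K) where
  toFun c := ∑ i, c i • A.form i
  map_add' x y := by
    simp [add_smul, Finset.sum_add_distrib]
  map_smul' t x := by
    simp [smul_smul, Finset.smul_sum]

/-- The relation space `F(A)`: the kernel of the evaluation map. -/
noncomputable def relSpace (A : CentralArrangement K ι n) : Submodule K (ι → K) :=
  LinearMap.ker A.evalMap

end CentralArrangement

open Classical in
/-- The support of a vector `c : ι → K`, as a finset. -/
noncomputable def vsupp {K ι : Type*} [Field K] [Fintype ι] (c : ι → K) : Finset ι :=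
  Finset.univ.filter fun j => c j ≠ 0

/-- The Orlik-Terao boundary `∂(c) = Σ_{j ∈ Λ} c_j · Π_{l ∈ Λ, l ≠ j} y_l`, where
`Λ` is the support of the dependency `c`. -/
noncomputable def otgen {K ι : Type*} [Field K] [Fintype ι] [DecidableEq ι] (c : ι → K) :
    MvPolynomial ι K :=
  ∑ j ∈ vsupp c, MvPolynomial.C (c j) * ∏ l ∈ (vsupp c).erase j, MvPolynomial.X l

namespace CentralArrangement

variable {K : Type*} [Field K] {ι : Type*} [Fintype ι] [DecidableEq ι] {n : ℕ}

/-- The Orlik-Terao ideal `I`, generated by `∂(c)` for all relations `c ∈ F(A)`. -/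
noncomputable def otIdeal (A : CentralArrangement K ι n) : Ideal (MvPolynomial ι K) :=
  Ideal.span (otgen '' (A.relSpace : Set (ι → K)))

/-- The quadratic component `I₂` of the Orlik-Terao ideal: the ideal generated by the
degree-2 (homogeneous) elements of `I`. -/
noncomputable def otQuadratic (A : CentralArrangement K ι n) : Ideal (MvPolynomial ι K) :=
  Ideal.span {f | f ∈ A.otIdeal ∧ f.IsHomogeneous 2}

/-- A 3-relation is an element of `F(A)` with support of size 3; the arrangement is
2-formal if the 3-relations span the relation space. -/
def IsTwoFormal (A : CentralArrangement K ι n) : Prop :=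
  Submodule.span K {c : ι → K | c ∈ A.relSpace ∧ (vsupp c).card = 3} = A.relSpace

end CentralArrangement
/-- The degree-`m` graded piece of `R/I`, the image of the homogeneous polynomials of
degree `m` in the quotient. -/
noncomputable def quotGradedPiece {K ι : Type*} [Field K] [Fintype ι]
    (I : Ideal (MvPolynomial ι K)) (m : ℕ) : Submodule K (MvPolynomial ι K ⧸ I) :=
  Submodule.map (Ideal.Quotient.mkₐ K I).toLinearMap (MvPolynomial.homogeneousSubmodule ι K m)

open MvPolynomial in
/-- The (Zariski) tangent space at `p` of the affine cone `V(I) ⊆ K^ι`: the kernel of the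
Jacobian of `I` at `p`. -/
noncomputable def jacTangentSpace {K ι : Type*} [Field K] [Fintype ι]
    (I : Ideal (MvPolynomial ι K)) (p : ι → K) : Submodule K (ι → K) where
  carrier := {v | ∀ f ∈ I, ∑ l, v l * eval p (pderiv l f) = 0}
  add_mem' := by
    intro v w hv hw f hf
    simpa [add_mul, Finset.sum_add_distrib] using by rw [hv f hf, hw f hf]; ring
  zero_mem' := by
    intro f hf
    simp
  smul_mem' := by
    intro t v hv f hf
    simp only [Pi.smul_apply, smul_eq_mul, mul_assoc, ← Finset.mul_sum]
    rw [hv f hf, mul_zero]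


open MvPolynomial

section Parametrization

variable {K : Type*} [Field K] {e : ℕ}

/-- The parametrization of the cone over the curve `t ↦ (p_0(t) : … : p_e(t))`, with the
cone coordinate as outer variable. -/
noncomputable def conePar (p : Fin (e + 1) → Polynomial K) :
    MvPolynomial (Fin (e + 1)) K →ₐ[K] Polynomial (Polynomial K) :=
  aeval fun i => Polynomial.C (p i) * Polynomial.X

theorem MvPolynomial.IsHomogeneous.mem_of_X_mul_mem {σ R : Type*} [CommSemiring R]
    {W : ℕ → Submodule R (MvPolynomial σ R)} (h0 : (1 : MvPolynomial σ R) ∈ W 0)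
    (hX : ∀ m i, ∀ f ∈ W m, X i * f ∈ W (m + 1))
    {m : ℕ} {f : MvPolynomial σ R} (hf : f.IsHomogeneous m) : f ∈ W m := by
  have key : ∀ n, ∀ s : σ →₀ ℕ, s.degree = n → monomial s (1 : R) ∈ W n := by
    intro n
    induction n with
    | zero =>
      intro s hs
      rw [Finsupp.degree_eq_zero_iff] at hs
      subst hs
      exact h0
    | succ n ih =>
      intro s hs
      have hs0 : s ≠ 0 := by
        rintro rfl
        simp at hs
      obtain ⟨i, hi⟩ := Finsupp.ne_iff.1 hs0
      have hle : Finsupp.single i 1 ≤ s := by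
        rw [Finsupp.single_le_iff]
        exact Nat.one_le_iff_ne_zero.2 hi
      obtain ⟨s', rfl⟩ := exists_add_of_le hle
      have : monomial (Finsupp.single i 1 + s') (1 : R) = X i * monomial s' 1 := by
        rw [X, monomial_mul, one_mul]
      rw [this]
      refine hX _ _ _ (ih _ ?_)
      simp only [map_add, Finsupp.degree_single] at hs
      omega
  rw [f.as_sum]
  refine Submodule.sum_mem _ fun s hs => ?_
  have : monomial s (coeff s f) = coeff s f • monomial s (1 : R) := by
    rw [smul_monomial, smul_eq_mul, mul_one]
  rw [this]
  refine Submodule.smul_mem _ _ (key _ _ ?_)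
  have := hf (mem_support_iff.1 hs)
  rw [Finsupp.degree_eq_weight_one]
  exact this

theorem conePar_of_isHomogeneous (p : Fin (e + 1) → Polynomial K) {m : ℕ}
    {f : MvPolynomial (Fin (e + 1)) K} (hf : f.IsHomogeneous m) :
    conePar p f = Polynomial.C (aeval p f) * Polynomial.X ^ m := by
  let W : ℕ → Submodule K (MvPolynomial (Fin (e + 1)) K) := fun m =>
    { carrier := {f | conePar p f = Polynomial.C (aeval p f) * Polynomial.X ^ m}
      add_mem' := by
        intro a b ha hb
        simp only [Set.mem_ofPred_eq] at ha hb ⊢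
        rw [map_add, ha, hb, map_add, map_add, add_mul]
      zero_mem' := by simp
      smul_mem' := by
        intro c a ha
        simp only [Set.mem_ofPred_eq] at ha ⊢
        rw [map_smul, ha, map_smul, ← Polynomial.smul_C, smul_mul_assoc] }
  refine hf.mem_of_X_mul_mem (W := W) ?_ ?_
  · change conePar p 1 = _
    simp
  · intro m i f hf
    change conePar p (X i * f) = _
    have hf' : conePar p f = Polynomial.C (aeval p f) * Polynomial.X ^ m := hf
    rw [map_mul, hf', map_mul, aeval_X, conePar, aeval_X, map_mul]
    ring

theorem exists_isHomogeneous_aeval_eq {p : Fin (e + 1) → Polynomial K}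
    (hp : ∀ w ≤ e, Polynomial.X ^ w ∈ Submodule.span K (Set.range p)) (m : ℕ) :
    ∀ w ≤ e * m, ∃ f : MvPolynomial (Fin (e + 1)) K,
      f.IsHomogeneous m ∧ aeval p f = Polynomial.X ^ w := by
  induction m with
  | zero =>
    intro w hw
    obtain rfl : w = 0 := by simpa using hw
    exact ⟨1, isHomogeneous_one _ _, by simp⟩
  | succ m ih =>
    intro w hw
    obtain ⟨w₁, w₂, rfl, h₁, h₂⟩ : ∃ w₁ w₂, w = w₁ + w₂ ∧ w₁ ≤ e * m ∧ w₂ ≤ e :=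
      ⟨w - min w e, min w e, by omega, by rw [Nat.mul_succ] at hw; omega, by omega⟩
    obtain ⟨f, hf, hfw⟩ := ih _ h₁
    obtain ⟨c, hc⟩ := (Submodule.mem_span_range_iff_exists_fun K).1 (hp _ h₂)
    refine ⟨f * ∑ i, C (c i) * X i, hf.mul (IsHomogeneous.sum _ _ _ fun i _ =>
      isHomogeneous_C_mul_X _ _), ?_⟩
    rw [map_mul, hfw, pow_add, ← hc]
    congr 1
    simp [Polynomial.smul_eq_C_mul]

theorem aeval_eq_zero_of_le_ker_conePar {p : Fin (e + 1) → Polynomial K}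
    {I : Ideal (MvPolynomial (Fin (e + 1)) K)} (hI : I ≤ RingHom.ker (conePar p))
    {g : MvPolynomial (Fin (e + 1)) K} (hg : g ∈ I) : aeval p g = 0 := by
  have h3 : ((Polynomial.aeval (1 : Polynomial K)).restrictScalars K).comp (conePar p)
      = aeval p := by
    ext i : 1
    simp [conePar]
  have h4 : conePar p g = 0 := hI hg
  rw [← h3, AlgHom.comp_apply, h4, map_zero]

theorem degreeLT_le_map_span {p : Fin (e + 1) → Polynomial K}
    (hp : ∀ w ≤ e, Polynomial.X ^ w ∈ Submodule.span K (Set.range p))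
    {I : Ideal (MvPolynomial (Fin (e + 1)) K)} (hI : I ≤ RingHom.ker (conePar p))
    {m : ℕ} {ι : Type*} (T : ι → MvPolynomial (Fin (e + 1)) K)
    (hT : homogeneousSubmodule (Fin (e + 1)) K m ≤
      I.restrictScalars K ⊔ Submodule.span K (Set.range T)) :
    Polynomial.degreeLT K (e * m + 1) ≤
      Submodule.span K (Set.range fun k => aeval p (T k)) := by
  classical
  rw [Polynomial.degreeLT_eq_span_X_pow, Submodule.span_le]
  intro g hg
  simp only [Finset.coe_image, Finset.coe_range, Set.mem_image, Set.mem_Iio] at hg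
  obtain ⟨w, hw, rfl⟩ := hg
  obtain ⟨f, hf, hfw⟩ := exists_isHomogeneous_aeval_eq hp m w (by omega)
  obtain ⟨g, hg, n, hn, rfl⟩ := Submodule.mem_sup.1 (hT hf)
  have hg0 := aeval_eq_zero_of_le_ker_conePar hI hg
  rw [map_add, hg0, zero_add] at hfw
  rw [← hfw, SetLike.mem_coe]
  have : Submodule.span K (Set.range fun k => aeval p (T k)) =
      (Submodule.span K (Set.range T)).map (aeval p).toLinearMap := by
    rw [Submodule.map_span, ← Set.range_comp]
    rfl
  rw [this]
  exact Submodule.mem_map_of_mem hn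

theorem linearIndependent_aeval {p : Fin (e + 1) → Polynomial K}
    (hp : ∀ w ≤ e, Polynomial.X ^ w ∈ Submodule.span K (Set.range p))
    {I : Ideal (MvPolynomial (Fin (e + 1)) K)} (hI : I ≤ RingHom.ker (conePar p))
    {m : ℕ} {ι : Type*} [Fintype ι] (hι : Fintype.card ι = e * m + 1)
    (T : ι → MvPolynomial (Fin (e + 1)) K)
    (hT : homogeneousSubmodule (Fin (e + 1)) K m ≤
      I.restrictScalars K ⊔ Submodule.span K (Set.range T)) :
    LinearIndependent K fun k => aeval p (T k) := by
  rw [linearIndependent_iff_card_le_finrank_span, hι]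
  have h1 : Module.finrank K (Polynomial.degreeLT K (e * m + 1)) = e * m + 1 := by
    rw [LinearEquiv.finrank_eq (Polynomial.degreeLTEquiv K (e * m + 1))]
    simp
  rw [← h1]
  have : FiniteDimensional K (Submodule.span K (Set.range fun k => aeval p (T k))) :=
    FiniteDimensional.span_of_finite K (Set.finite_range _)
  exact Submodule.finrank_mono (degreeLT_le_map_span hp hI T hT)

theorem eq_ker_conePar {p : Fin (e + 1) → Polynomial K}
    (hp : ∀ w ≤ e, Polynomial.X ^ w ∈ Submodule.span K (Set.range p))
    {I : Ideal (MvPolynomial (Fin (e + 1)) K)} (hI : I ≤ RingHom.ker (conePar p))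
    (T : ∀ m, Option (Fin m × Fin e) → MvPolynomial (Fin (e + 1)) K)
    (hT : ∀ m, homogeneousSubmodule (Fin (e + 1)) K m ≤
      I.restrictScalars K ⊔ Submodule.span K (Set.range (T m))) :
    I = RingHom.ker (conePar p) := by
  refine le_antisymm hI fun f hf => ?_
  have hcomp : ∀ m, aeval p (homogeneousComponent m f) = 0 := by
    intro m
    have h1 : conePar p f = 0 := hf
    rw [← sum_homogeneousComponent f, map_sum] at h1
    by_cases hm : m ∈ Finset.range (f.totalDegree + 1)
    · have := congrArg (fun q => Polynomial.coeff q m) h1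
      simp only [conePar_of_isHomogeneous p (homogeneousComponent_isHomogeneous _ f),
        Polynomial.finsetSum_coeff, Polynomial.coeff_C_mul_X_pow, Polynomial.coeff_zero] at this
      rwa [Finset.sum_ite_eq, if_pos hm] at this
    · rw [homogeneousComponent_eq_zero _ _ (by simpa using hm), map_zero]
  rw [← sum_homogeneousComponent f]
  refine Ideal.sum_mem _ fun m _ => ?_
  obtain ⟨g, hg, n, hn, hgn⟩ :=
    Submodule.mem_sup.1 (hT m (homogeneousComponent_isHomogeneous m f))
  have hli := linearIndependent_aeval hp hI (m := m) (by simp [mul_comm]) (T m) (hT m)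
  have hn0 : n = 0 := by
    obtain ⟨c, rfl⟩ := (Submodule.mem_span_range_iff_exists_fun K).1 hn
    have h2 : aeval p (∑ k, c k • T m k) = 0 := by
      have hg0 : aeval p (g + ∑ k, c k • T m k) = 0 := by rw [hgn, hcomp]
      have h5 := aeval_eq_zero_of_le_ker_conePar hI hg
      rwa [map_add, h5, zero_add] at hg0
    simp only [map_sum, map_smul] at h2
    have := Fintype.linearIndependent_iff.1 hli c h2
    simp [this]
  rw [← hgn, hn0, add_zero]
  exact hg

theorem finrank_quotGradedPiece {p : Fin (e + 1) → Polynomial K}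
    (hp : ∀ w ≤ e, Polynomial.X ^ w ∈ Submodule.span K (Set.range p))
    {I : Ideal (MvPolynomial (Fin (e + 1)) K)} (hI : I ≤ RingHom.ker (conePar p))
    (T : ∀ m, Option (Fin m × Fin e) → MvPolynomial (Fin (e + 1)) K)
    (hTh : ∀ m k, (T m k).IsHomogeneous m)
    (hT : ∀ m, homogeneousSubmodule (Fin (e + 1)) K m ≤
      I.restrictScalars K ⊔ Submodule.span K (Set.range (T m))) (m : ℕ) :
    Module.finrank K (quotGradedPiece I m) = e * m + 1 := by
  have hcard : Fintype.card (Option (Fin m × Fin e)) = e * m + 1 := by simp [mul_comm]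
  have hli := linearIndependent_aeval hp hI hcard (T m) (hT m)
  have hspan : quotGradedPiece I m =
      Submodule.span K (Set.range fun k => Ideal.Quotient.mkₐ K I (T m k)) := by
    have h1 : Submodule.span K (Set.range fun k => Ideal.Quotient.mkₐ K I (T m k)) =
        (Submodule.span K (Set.range (T m))).map (Ideal.Quotient.mkₐ K I).toLinearMap := by
      rw [Submodule.map_span, ← Set.range_comp]
      rfl
    rw [h1, quotGradedPiece]
    apply le_antisymm
    · rintro _ ⟨f, hf, rfl⟩
      obtain ⟨g, hg, n, hn, rfl⟩ := Submodule.mem_sup.1 (hT m hf)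
      refine ⟨n, hn, ?_⟩
      have : Ideal.Quotient.mkₐ K I g = 0 := Ideal.Quotient.eq_zero_iff_mem.2 hg
      simp only [AlgHom.toLinearMap_apply, map_add, this, zero_add]
    · refine Submodule.map_mono (Submodule.span_le.2 ?_)
      rintro _ ⟨k, rfl⟩
      exact hTh m k
  have hker : ∀ g ∈ I, aeval p g = 0 := fun g hg => aeval_eq_zero_of_le_ker_conePar hI hg
  have hli' : LinearIndependent K fun k => Ideal.Quotient.mkₐ K I (T m k) := by
    refine LinearIndependent.of_comp (Ideal.Quotient.liftₐ I (aeval p) hker).toLinearMap ?_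
    exact hli
  rw [hspan, finrank_span_eq_card hli', hcard]

end Parametrization

section LineProducts

variable {K : Type*} [Field K] {e : ℕ}

/-- The product of the linear polynomials `u_j + v_j t` over all `j ≠ i`. -/
noncomputable def lineProd (u v : Fin (e + 1) → K) (i : Fin (e + 1)) : Polynomial K :=
  ∏ j ∈ Finset.univ.erase i, (Polynomial.C (u j) + Polynomial.C (v j) * Polynomial.X)

/-- The matrix of coefficients of the polynomials `lineProd u v i`. -/
noncomputable def lineProdMatrix (u v : Fin (e + 1) → K) :
    Matrix (Fin (e + 1)) (Fin (e + 1)) K :=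
  Matrix.of fun i j => (lineProd u v i).coeff j

theorem natDegree_line_le (a b : K) :
    (Polynomial.C a + Polynomial.C b * Polynomial.X).natDegree ≤ 1 := by
  rw [add_comm]
  exact Polynomial.natDegree_linear_le

theorem natDegree_lineProd_le (u v : Fin (e + 1) → K) (i : Fin (e + 1)) :
    (lineProd u v i).natDegree ≤ e := by
  refine (Polynomial.natDegree_prod_le _ _).trans ?_
  refine (Finset.sum_le_card_nsmul _ _ 1 fun j _ => natDegree_line_le _ _).trans ?_
  simp

theorem coeff_lineProd (u v : Fin (e + 1) → K) (i : Fin (e + 1)) :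
    (lineProd u v i).coeff e = ∏ j ∈ Finset.univ.erase i, v j := by
  have := Polynomial.coeff_prod_of_natDegree_le (s := Finset.univ.erase i)
    (fun j => Polynomial.C (u j) + Polynomial.C (v j) * Polynomial.X) 1
    (fun j _ => natDegree_line_le _ _)
  simpa [lineProd] using this

theorem eval_lineProd (u v : Fin (e + 1) → K) (i : Fin (e + 1)) (t : K) :
    (lineProd u v i).eval t = ∏ j ∈ Finset.univ.erase i, (u j + v j * t) := by
  simp [lineProd, Polynomial.eval_prod]

theorem lineProd_eq_sum (u v : Fin (e + 1) → K) (i : Fin (e + 1)) :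
    lineProd u v i = ∑ j : Fin (e + 1),
      Polynomial.C (lineProdMatrix u v i j) * Polynomial.X ^ (j : ℕ) := by
  conv_lhs => rw [Polynomial.as_sum_range_C_mul_X_pow' (lineProd u v i)
    (Nat.lt_succ_of_le (natDegree_lineProd_le u v i))]
  rw [Finset.sum_range]
  rfl

theorem linearIndependent_lineProd {u v : Fin (e + 1) → K}
    (h : ∀ i j, i ≠ j → u i * v j - u j * v i ≠ 0) :
    LinearIndependent K (lineProd u v) := by
  rw [Fintype.linearIndependent_iff]
  intro c hc k
  by_cases hk : v k = 0
  · have h1 := congrArg (fun q => Polynomial.coeff q e) hc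
    simp only [Polynomial.finsetSum_coeff, Polynomial.coeff_smul, coeff_lineProd,
      Polynomial.coeff_zero, smul_eq_mul] at h1
    rw [Finset.sum_eq_single k] at h1
    · refine (mul_eq_zero.1 h1).resolve_right (Finset.prod_ne_zero_iff.2 fun j hj hj0 => ?_)
      exact h k j (Finset.ne_of_mem_erase hj).symm (by rw [hk, hj0]; ring)
    · intro i _ hi
      rw [Finset.prod_eq_zero (Finset.mem_erase.2 ⟨hi.symm, Finset.mem_univ k⟩) hk, mul_zero]
    · simp
  · have h1 := congrArg (fun q => Polynomial.eval (-(u k / v k)) q) hc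
    simp only [Polynomial.eval_finsetSum, Polynomial.eval_smul, eval_lineProd,
      Polynomial.eval_zero, smul_eq_mul] at h1
    rw [Finset.sum_eq_single k] at h1
    · refine (mul_eq_zero.1 h1).resolve_right (Finset.prod_ne_zero_iff.2 fun j hj hj0 => ?_)
      refine h k j (Finset.ne_of_mem_erase hj).symm ?_
      field_simp at hj0
      linear_combination -hj0
    · intro i _ hi
      rw [Finset.prod_eq_zero (Finset.mem_erase.2 ⟨hi.symm, Finset.mem_univ k⟩), mul_zero]
      field_simp
      ring
    · simp

theorem isUnit_lineProdMatrix {u v : Fin (e + 1) → K}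
    (h : ∀ i j, i ≠ j → u i * v j - u j * v i ≠ 0) : IsUnit (lineProdMatrix u v) := by
  rw [← Matrix.linearIndependent_rows_iff_isUnit, Fintype.linearIndependent_iff]
  intro c hc
  refine Fintype.linearIndependent_iff.1 (linearIndependent_lineProd h) c ?_
  simp_rw [lineProd_eq_sum u v, Finset.smul_sum]
  rw [Finset.sum_comm]
  refine Finset.sum_eq_zero fun j _ => ?_
  have h1 := congrFun hc j
  simp only [Finset.sum_apply, Pi.smul_apply, smul_eq_mul, Pi.zero_apply, Matrix.row] at h1
  simp_rw [Polynomial.smul_eq_C_mul, ← mul_assoc, ← Polynomial.C_mul]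
  rw [← Finset.sum_mul, ← map_sum, h1]
  simp

theorem X_pow_mem_span_lineProd {u v : Fin (e + 1) → K}
    (h : ∀ i j, i ≠ j → u i * v j - u j * v i ≠ 0) {w : ℕ} (hw : w ≤ e) :
    Polynomial.X ^ w ∈ Submodule.span K (Set.range (lineProd u v)) := by
  have hu := (Matrix.isUnit_iff_isUnit_det _).1 (isUnit_lineProdMatrix h)
  refine (Submodule.mem_span_range_iff_exists_fun K).2
    ⟨fun i => (lineProdMatrix u v)⁻¹ ⟨w, Nat.lt_succ_of_le hw⟩ i, ?_⟩
  simp_rw [lineProd_eq_sum u v, Finset.smul_sum]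
  rw [Finset.sum_comm]
  simp_rw [Polynomial.smul_eq_C_mul, ← mul_assoc, ← Polynomial.C_mul, ← Finset.sum_mul,
    ← map_sum, ← Matrix.mul_apply, Matrix.nonsing_inv_mul _ hu, Matrix.one_apply]
  rw [Finset.sum_eq_single ⟨w, Nat.lt_succ_of_le hw⟩]
  · simp
  · intro j _ hj
    simp [hj.symm]
  · simp

theorem sum_mul_prod_erase_eq_zero {B ι : Type*} [CommRing B] [IsDomain B] [DecidableEq ι]
    {s : Finset ι} {c L Q : ι → B} {N : B} (hL : ∀ i ∈ s, L i ≠ 0)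
    (hQ : ∀ i ∈ s, Q i * L i = N) (hc : ∑ j ∈ s, c j * L j = 0) :
    ∑ j ∈ s, c j * ∏ l ∈ s.erase j, Q l = 0 := by
  have h0 : ∏ l ∈ s, L l ≠ 0 := Finset.prod_ne_zero_iff.2 hL
  refine (mul_eq_zero.1 ?_).resolve_right h0
  rw [Finset.sum_mul]
  have : ∀ j ∈ s, (c j * ∏ l ∈ s.erase j, Q l) * ∏ l ∈ s, L l =
      c j * L j * N ^ (s.card - 1) := by
    intro j hj
    rw [← Finset.mul_prod_erase s L hj]
    have h1 : (∏ l ∈ s.erase j, Q l) * ∏ l ∈ s.erase j, L l = N ^ (s.card - 1) := by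
      rw [← Finset.prod_mul_distrib, Finset.prod_congr rfl
        fun l hl => hQ l (Finset.mem_of_mem_erase hl), Finset.prod_const,
        Finset.card_erase_of_mem hj]
    rw [← h1]
    ring
  rw [Finset.sum_congr rfl this, ← Finset.sum_mul, hc, zero_mul]

theorem conePar_lineProd_otgen {u v : Fin (e + 1) → K}
    (h : ∀ i, u i ≠ 0 ∨ v i ≠ 0) {c : Fin (e + 1) → K}
    (hu : ∑ i, c i * u i = 0) (hv : ∑ i, c i * v i = 0) :
    conePar (lineProd u v) (otgen c) = 0 := by
  have hsupp : ∀ w : Fin (e + 1) → K, ∑ i ∈ vsupp c, c i * w i = ∑ i, c i * w i := by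
    intro w
    refine Finset.sum_subset (Finset.subset_univ _) fun i _ hi => ?_
    have : c i = 0 := by simpa [vsupp] using hi
    rw [this, zero_mul]
  have key := sum_mul_prod_erase_eq_zero (s := vsupp c)
    (c := fun i => Polynomial.C (Polynomial.C (c i)))
    (L := fun i => Polynomial.C (Polynomial.C (u i) + Polynomial.C (v i) * Polynomial.X))
    (Q := fun i => Polynomial.C (lineProd u v i) * Polynomial.X)
    (N := Polynomial.C (∏ i, (Polynomial.C (u i) + Polynomial.C (v i) * Polynomial.X)) *
      Polynomial.X) ?_ ?_ ?_
  · rw [← key, otgen, map_sum]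
    refine Finset.sum_congr rfl fun j _ => ?_
    rw [map_mul, map_prod]
    congr 1
    · simp [conePar]
    · refine Finset.prod_congr rfl fun l _ => ?_
      simp [conePar]
  · intro i _ h0
    rw [Polynomial.C_eq_zero] at h0
    have h1 := congrArg (fun q => Polynomial.coeff q 0) h0
    have h2 := congrArg (fun q => Polynomial.coeff q 1) h0
    simp at h1 h2
    rcases h i with h | h
    · exact h h1
    · exact h h2
  · intro i _
    rw [← Finset.mul_prod_erase Finset.univ _ (Finset.mem_univ i), lineProd]
    simp only [map_mul]
    ring
  · simp_rw [← Polynomial.C_mul]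
    rw [← map_sum]
    simp_rw [mul_add, ← mul_assoc, ← Polynomial.C_mul]
    rw [Finset.sum_add_distrib, ← Finset.sum_mul, ← map_sum, ← map_sum, hsupp, hsupp, hu, hv]
    simp

end LineProducts

namespace CentralArrangement

variable {K : Type*} [Field K]

/-- The determinant of the pair of forms `α_i, α_j` of a rank 2 arrangement. -/
def formDet {ι : Type*} [Fintype ι] (A : CentralArrangement K ι 2) (i j : ι) : K :=
  A.form i 0 * A.form j 1 - A.form j 0 * A.form i 1

theorem formDet_ne_zero {ι : Type*} [Fintype ι] (A : CentralArrangement K ι 2) {i j : ι}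
    (hij : i ≠ j) : A.formDet i j ≠ 0 := by
  intro h
  rw [formDet, sub_eq_zero] at h
  by_cases h0 : A.form j 0 = 0
  · have h1 : A.form j 1 ≠ 0 := by
      intro h1
      refine A.nonzero j (funext fun l => ?_)
      fin_cases l
      · exact h0
      · exact h1
    refine A.nonProportional i j hij (A.form i 1 / A.form j 1) (funext fun l => ?_)
    fin_cases l
    · simp only [Fin.zero_eta, Pi.smul_apply, smul_eq_mul, h0, zero_mul, mul_zero] at h ⊢
      exact (mul_eq_zero.1 h).resolve_right h1
    · simp [h1]
  · refine A.nonProportional i j hij (A.form i 0 / A.form j 0) (funext fun l => ?_)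
    fin_cases l
    · simp [h0]
    · simp
      field_simp
      linear_combination -h

/-- The value at `x` of the `i`-th form of a rank 2 arrangement. -/
def formEval {ι : Type*} [Fintype ι] (A : CentralArrangement K ι 2) (x : Fin 2 → K) (i : ι) : K :=
  A.form i 0 * x 0 + A.form i 1 * x 1

theorem sum_mul_formEval {ι : Type*} [Fintype ι] (A : CentralArrangement K ι 2) {c : ι → K}
    (hc : c ∈ A.relSpace) (x : Fin 2 → K) : ∑ i, c i * A.formEval x i = 0 := by
  have h : ∀ l, ∑ i, c i * A.form i l = 0 := by
    intro l
    have h1 : ∑ i, c i • A.form i = 0 := hc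
    simpa using congrFun h1 l
  simp_rw [formEval, mul_add, ← mul_assoc]
  rw [Finset.sum_add_distrib, ← Finset.sum_mul, ← Finset.sum_mul, h, h]
  simp

theorem formEval_det_ne_zero {ι : Type*} [Fintype ι] (A : CentralArrangement K ι 2)
    {x y : Fin 2 → K} (hxy : x 0 * y 1 - x 1 * y 0 ≠ 0) {i j : ι} (hij : i ≠ j) :
    A.formEval x i * A.formEval y j - A.formEval x j * A.formEval y i ≠ 0 := by
  have : A.formEval x i * A.formEval y j - A.formEval x j * A.formEval y i =
      A.formDet i j * (x 0 * y 1 - x 1 * y 0) := by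
    simp only [formEval, formDet]
    ring
  rw [this]
  exact mul_ne_zero (A.formDet_ne_zero hij) hxy

theorem otIdeal_le_ker {e : ℕ} (he : 1 ≤ e) (A : CentralArrangement K (Fin (e + 1)) 2)
    {x y : Fin 2 → K} (hxy : x 0 * y 1 - x 1 * y 0 ≠ 0) :
    A.otIdeal ≤ RingHom.ker (conePar (lineProd (A.formEval x) (A.formEval y))) := by
  rw [otIdeal, Ideal.span_le]
  rintro _ ⟨c, hc, rfl⟩
  refine conePar_lineProd_otgen (fun i => ?_) (A.sum_mul_formEval hc x)
    (A.sum_mul_formEval hc y)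
  have : Nontrivial (Fin (e + 1)) := Fin.nontrivial_iff_two_le.2 (by omega)
  obtain ⟨j, hj⟩ := exists_ne i
  by_contra! h
  refine A.formEval_det_ne_zero hxy hj ?_
  rw [h.1, h.2]
  ring

theorem threeRelation_mem {ι : Type*} [Fintype ι] [DecidableEq ι]
    (A : CentralArrangement K ι 2) {i j k : ι} (hij : i ≠ j) (hik : i ≠ k) (hjk : j ≠ k) :
    C (A.formDet j k) * (X j * X k) + C (A.formDet k i) * (X i * X k) +
      C (A.formDet i j) * (X i * X j) ∈ A.otIdeal := by
  classical
  set c : ι → K := Pi.single i (A.formDet j k) + Pi.single j (A.formDet k i) +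
    Pi.single k (A.formDet i j) with hc
  have ci : c i = A.formDet j k := by simp [hc, hij, hik]
  have cj : c j = A.formDet k i := by simp [hc, hij.symm, hjk]
  have ck : c k = A.formDet i j := by simp [hc, hik.symm, hjk.symm]
  have hs : vsupp c = {i, j, k} := by
    ext l
    simp only [vsupp, Finset.mem_filter, Finset.mem_univ, true_and, Finset.mem_insert,
      Finset.mem_singleton]
    constructor
    · contrapose!
      rintro ⟨h1, h2, h3⟩
      simp [hc, h1, h2, h3]
    · rintro (rfl | rfl | rfl)
      · rw [ci]; exact A.formDet_ne_zero hjk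
      · rw [cj]; exact A.formDet_ne_zero hik.symm
      · rw [ck]; exact A.formDet_ne_zero hij
  have hmem : c ∈ A.relSpace := by
    change ∑ l, c l • A.form l = 0
    rw [← Finset.sum_subset (Finset.subset_univ ({i, j, k} : Finset ι))]
    · rw [Finset.sum_insert (by simp [hij, hik]), Finset.sum_insert (by simp [hjk]),
        Finset.sum_singleton, ci, cj, ck]
      ext l
      fin_cases l
      · simp [formDet]; ring
      · simp [formDet]; ring
    · intro l _ hl
      rw [← hs] at hl
      have : c l = 0 := by simpa [vsupp] using hl
      rw [this, zero_smul]
  have := Ideal.subset_span (s := otgen '' (A.relSpace : Set (ι → K))) ⟨c, hmem, rfl⟩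
  rw [otgen, hs, Finset.sum_insert (by simp [hij, hik]), Finset.sum_insert (by simp [hjk]),
    Finset.sum_singleton, ci, cj, ck] at this
  have e1 : ({i, j, k} : Finset ι).erase i = {j, k} := by
    rw [Finset.erase_insert (by simp [hij, hik])]
  have e2 : ({i, j, k} : Finset ι).erase j = {i, k} := by
    rw [Finset.insert_comm, Finset.erase_insert (by simp [hij.symm, hjk])]
  have e3 : ({i, j, k} : Finset ι).erase k = {i, j} := by
    rw [Finset.pair_comm j k, Finset.insert_comm,
      Finset.erase_insert (by simp [hik.symm, hjk.symm])]
  rw [e1, e2, e3, Finset.prod_pair hjk, Finset.prod_pair hik, Finset.prod_pair hij,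
    ← add_assoc] at this
  exact this

end CentralArrangement

section Spanning

variable {K : Type*} [Field K] {e : ℕ}

theorem X_mul_mem_of_range {I : Ideal (MvPolynomial (Fin (e + 1)) K)}
    {ι ι' : Type*} {T : ι → MvPolynomial (Fin (e + 1)) K} {T' : ι' → MvPolynomial (Fin (e + 1)) K}
    {q : MvPolynomial (Fin (e + 1)) K}
    (h : ∀ k, q * T k ∈ I.restrictScalars K ⊔ Submodule.span K (Set.range T')) :
    ∀ f ∈ I.restrictScalars K ⊔ Submodule.span K (Set.range T),
      q * f ∈ I.restrictScalars K ⊔ Submodule.span K (Set.range T') := by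
  intro f hf
  obtain ⟨g, hg, n, hn, rfl⟩ := Submodule.mem_sup.1 hf
  rw [mul_add]
  refine Submodule.add_mem _ (Submodule.mem_sup_left (I.mul_mem_left _ hg)) ?_
  have : Submodule.span K (Set.range T) ≤ (I.restrictScalars K ⊔
      Submodule.span K (Set.range T')).comap (LinearMap.mulLeft K q) := by
    rw [Submodule.span_le]
    rintro _ ⟨k, rfl⟩
    exact h k
  exact this hn

/-- The monomials `y_0^m` and `y_0^a y_i^(m-a)` with `a < m`, `i ≠ 0`. -/
noncomputable def starMonomial (K : Type*) [Field K] (e m : ℕ) :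
    Option (Fin m × Fin e) → MvPolynomial (Fin (e + 1)) K
  | none => X 0 ^ m
  | some (a, i) => X 0 ^ (a : ℕ) * X i.succ ^ (m - a)

theorem starMonomial_isHomogeneous (m : ℕ) (k : Option (Fin m × Fin e)) :
    (starMonomial K e m k).IsHomogeneous m := by
  match k with
  | none => exact isHomogeneous_X_pow _ _
  | some (a, i) =>
    have := (isHomogeneous_X_pow (R := K) (0 : Fin (e + 1)) a).mul
      (isHomogeneous_X_pow i.succ (m - a))
    rwa [Nat.add_sub_cancel' a.2.le] at this

theorem mem_range_starMonomial (a b : ℕ) (i : Fin (e + 1)) :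
    (X 0 ^ a * X i ^ b : MvPolynomial (Fin (e + 1)) K) ∈
      Set.range (starMonomial K e (a + b)) := by
  rcases Nat.eq_zero_or_pos b with rfl | hb
  · exact ⟨none, by simp [starMonomial]⟩
  · refine Fin.cases ?_ (fun i => ?_) i
    · exact ⟨none, by simp [starMonomial, pow_add]⟩
    · exact ⟨some (⟨a, by omega⟩, i), by simp [starMonomial]⟩

theorem CentralArrangement.X_mul_X_pow_mem (A : CentralArrangement K (Fin (e + 1)) 2)
    (j k : Fin (e + 1)) (b : ℕ) : ∀ a, X j * (X 0 ^ a * X k ^ b) ∈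
      A.otIdeal.restrictScalars K ⊔ Submodule.span K (Set.range (starMonomial K e (a + b + 1))) := by
  have mem : ∀ a b (i : Fin (e + 1)) n, a + b = n →
      (X 0 ^ a * X i ^ b : MvPolynomial (Fin (e + 1)) K) ∈
      A.otIdeal.restrictScalars K ⊔ Submodule.span K (Set.range (starMonomial K e n)) := by
    rintro a b i _ rfl
    exact Submodule.mem_sup_right (Submodule.subset_span (mem_range_starMonomial a b i))
  by_cases hj : j = 0
  · subst hj
    intro a
    convert mem (a + 1) b k (a + b + 1) (by omega) using 1
    ring
  by_cases hjk : j = k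
  · subst hjk
    intro a
    convert mem a (b + 1) j (a + b + 1) (by omega) using 1
    ring
  by_cases hk : k = 0
  · subst hk
    intro a
    convert mem (a + b) 1 j (a + b + 1) (by omega) using 1
    ring
  induction b with
  | zero =>
    intro a
    convert mem a 1 j (a + 0 + 1) (by omega) using 1
    ring
  | succ b ih =>
    intro a
    have hd := A.formDet_ne_zero hjk
    rw [← Submodule.smul_mem_iff _ hd]
    have hq := A.threeRelation_mem (Ne.symm hj) (Ne.symm hk) hjk
    have h1 := mem (a + 1) (b + 1) k (a + (b + 1) + 1) (by omega)
    have h2 := ih (a + 1)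
    rw [show a + 1 + b + 1 = a + (b + 1) + 1 by omega] at h2
    have h3 : (C (A.formDet j k) * (X j * X k) + C (A.formDet k 0) * (X 0 * X k) +
      C (A.formDet 0 j) * (X 0 * X j)) * (X 0 ^ a * X k ^ b) ∈ A.otIdeal.restrictScalars K ⊔
        Submodule.span K (Set.range (starMonomial K e (a + (b + 1) + 1))) :=
      Submodule.mem_sup_left (A.otIdeal.mul_mem_right _ hq)
    convert Submodule.sub_mem _ (Submodule.sub_mem _ h3
      (Submodule.smul_mem _ (A.formDet k 0) h1)) (Submodule.smul_mem _ (A.formDet 0 j) h2) using 1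
    simp only [smul_eq_C_mul]
    ring

theorem CentralArrangement.homogeneousSubmodule_le
    (A : CentralArrangement K (Fin (e + 1)) 2) (m : ℕ) :
    homogeneousSubmodule (Fin (e + 1)) K m ≤
      A.otIdeal.restrictScalars K ⊔ Submodule.span K (Set.range (starMonomial K e m)) := by
  intro f hf
  refine IsHomogeneous.mem_of_X_mul_mem (W := fun m => A.otIdeal.restrictScalars K ⊔
    Submodule.span K (Set.range (starMonomial K e m))) ?_ ?_ hf
  · exact Submodule.mem_sup_right (Submodule.subset_span ⟨none, by simp [starMonomial]⟩)
  · intro m i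
    refine X_mul_mem_of_range fun k => ?_
    match k with
    | none =>
      convert A.X_mul_X_pow_mem i 0 0 m using 1
      simp [starMonomial]
    | some (a, k) =>
      have h := A.X_mul_X_pow_mem i k.succ (m - a) a
      rwa [Nat.add_sub_cancel' a.2.le] at h

/-- The ideal of the standard rational normal curve, generated by the `2 × 2` minors of the
matrix with rows `(X_0, …, X_{e-1})` and `(X_1, …, X_e)`. -/
noncomputable def minorIdeal (K : Type*) [Field K] (e : ℕ) :
    Ideal (MvPolynomial (Fin (e + 1)) K) :=
  Ideal.span {g | ∃ i j : ℕ, ∃ (hi : i + 1 < e + 1) (hj : j + 1 < e + 1),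
    g = X ⟨i, by omega⟩ * X ⟨j + 1, hj⟩ - X ⟨i + 1, hi⟩ * X ⟨j, by omega⟩}

theorem X_mul_X_sub_mem_minorIdeal (k : ℕ) : ∀ (i j : ℕ) (hi : i + k < e + 1)
    (hj : j + k < e + 1), (X ⟨i + k, hi⟩ * X ⟨j, by omega⟩ - X ⟨i, by omega⟩ * X ⟨j + k, hj⟩ :
      MvPolynomial (Fin (e + 1)) K) ∈ minorIdeal K e := by
  induction k with
  | zero => intro i j hi hj; simp
  | succ k ih =>
    intro i j hi hj
    have h1 := ih i (j + 1) (by omega) (by omega)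
    have h2 : (X ⟨i + k, by omega⟩ * X ⟨j + 1, by omega⟩ -
        X ⟨i + k + 1, by omega⟩ * X ⟨j, by omega⟩ : MvPolynomial (Fin (e + 1)) K) ∈
        minorIdeal K e :=
      Ideal.subset_span ⟨i + k, j, by omega, by omega, rfl⟩
    have h3 : j + (k + 1) = j + 1 + k := by omega
    convert Ideal.sub_mem _ h1 h2 using 1
    simp only [h3, ← add_assoc]
    ring

/-- The monomials `X_0^m` and `X_e^a X_0^(m-1-a) X_i` with `a < m`, `i ≠ 0`. -/
noncomputable def chainMonomial (K : Type*) [Field K] (e m : ℕ) :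
    Option (Fin m × Fin e) → MvPolynomial (Fin (e + 1)) K
  | none => X 0 ^ m
  | some (a, i) => X (Fin.last e) ^ (a : ℕ) * X 0 ^ (m - 1 - a) * X i.succ

theorem mem_range_chainMonomial (he : 1 ≤ e) (a b n : ℕ) (hn : a + b + 1 = n)
    (i : Fin (e + 1)) :
    (X (Fin.last e) ^ a * X 0 ^ b * X i : MvPolynomial (Fin (e + 1)) K) ∈
      Set.range (chainMonomial K e n) := by
  subst hn
  obtain ⟨e, rfl⟩ : ∃ e', e = e' + 1 := ⟨e - 1, by omega⟩
  refine Fin.cases ?_ (fun i => ?_) i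
  · cases a with
    | zero => exact ⟨none, by simp [chainMonomial, pow_succ]⟩
    | succ a =>
      refine ⟨some (⟨a, by omega⟩, Fin.last e), ?_⟩
      have : a + 1 + b + 1 - 1 - a = b + 1 := by omega
      simp only [chainMonomial, this, Fin.succ_last]
      ring
  · refine ⟨some (⟨a, by omega⟩, i), ?_⟩
    have : a + b + 1 - 1 - a = b := by omega
    simp only [chainMonomial, this]

theorem X_mul_chain_mem (he : 1 ≤ e) (a b n : ℕ) (hn : a + b + 2 = n) (i j : Fin (e + 1)) :
    X i * (X (Fin.last e) ^ a * X 0 ^ b * X j) ∈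
      (minorIdeal K e).restrictScalars K ⊔ Submodule.span K (Set.range (chainMonomial K e n)) := by
  have mem : ∀ a b (i : Fin (e + 1)), a + b + 1 = n →
      (X (Fin.last e) ^ a * X 0 ^ b * X i : MvPolynomial (Fin (e + 1)) K) ∈
      (minorIdeal K e).restrictScalars K ⊔ Submodule.span K (Set.range (chainMonomial K e n)) :=
    fun a b i h => Submodule.mem_sup_right (Submodule.subset_span
      (mem_range_chainMonomial he a b n h i))
  obtain ⟨i, hi⟩ := i
  obtain ⟨j, hj⟩ := j
  by_cases hij : i + j ≤ e
  · have h1 := X_mul_X_sub_mem_minorIdeal (K := K) (e := e) i 0 j (by omega) (by omega)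
    have h2 : _ ∈ (minorIdeal K e).restrictScalars K ⊔
        Submodule.span K (Set.range (chainMonomial K e n)) := Submodule.mem_sup_left
      ((minorIdeal K e).mul_mem_left (X (Fin.last e) ^ a * X 0 ^ b) h1)
    convert Submodule.add_mem _ h2 (mem a (b + 1) ⟨j + i, by omega⟩ (by omega)) using 1
    simp only [zero_add, Fin.mk_zero']
    ring
  · have h1 := X_mul_X_sub_mem_minorIdeal (K := K) (e := e) (e - j) (i + j - e) j
      (by omega) (by omega)
    have h2 : _ ∈ (minorIdeal K e).restrictScalars K ⊔
        Submodule.span K (Set.range (chainMonomial K e n)) := Submodule.mem_sup_left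
      ((minorIdeal K e).mul_mem_left (X (Fin.last e) ^ a * X 0 ^ b) h1)
    convert Submodule.add_mem _ h2 (mem (a + 1) b ⟨i + j - e, by omega⟩ (by omega)) using 1
    have h3 : i + j - e + (e - j) = i := by omega
    have h4 : j + (e - j) = e := by omega
    simp only [h3, h4, Fin.last]
    ring

theorem homogeneousSubmodule_le_minorIdeal (he : 1 ≤ e) (m : ℕ) :
    homogeneousSubmodule (Fin (e + 1)) K m ≤ (minorIdeal K e).restrictScalars K ⊔
      Submodule.span K (Set.range (chainMonomial K e m)) := by
  intro f hf
  refine IsHomogeneous.mem_of_X_mul_mem (W := fun m => (minorIdeal K e).restrictScalars K ⊔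
    Submodule.span K (Set.range (chainMonomial K e m))) ?_ ?_ hf
  · exact Submodule.mem_sup_right (Submodule.subset_span ⟨none, by simp [chainMonomial]⟩)
  · intro m i
    refine X_mul_mem_of_range fun k => ?_
    match k with
    | none =>
      refine Submodule.mem_sup_right (Submodule.subset_span ?_)
      convert mem_range_chainMonomial he 0 m (m + 1) (by omega) i using 1
      simp only [chainMonomial]
      ring
    | some (a, k) => exact X_mul_chain_mem he a (m - 1 - a) (m + 1) (by omega) i k.succ

theorem minorIdeal_eq_ker (he : 1 ≤ e) :
    minorIdeal K e =
      RingHom.ker (conePar fun i : Fin (e + 1) => (Polynomial.X : Polynomial K) ^ (i : ℕ)) := by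
  refine eq_ker_conePar (fun w hw => Submodule.subset_span ⟨⟨w, by omega⟩, rfl⟩) ?_
    (chainMonomial K e) (homogeneousSubmodule_le_minorIdeal he)
  rw [minorIdeal, Ideal.span_le]
  rintro _ ⟨i, j, hi, hj, rfl⟩
  simp only [SetLike.mem_coe, RingHom.mem_ker, map_sub, map_mul, conePar, aeval_X, map_pow]
  ring

theorem CentralArrangement.otIdeal_eq_ker (he : 1 ≤ e) (A : CentralArrangement K (Fin (e + 1)) 2)
    {x y : Fin 2 → K} (hxy : x 0 * y 1 - x 1 * y 0 ≠ 0) :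
    A.otIdeal = RingHom.ker (conePar (lineProd (A.formEval x) (A.formEval y))) :=
  eq_ker_conePar (fun _ hw => X_pow_mem_span_lineProd
    (fun _ _ h => A.formEval_det_ne_zero hxy h) hw) (A.otIdeal_le_ker he hxy)
    (starMonomial K e) A.homogeneousSubmodule_le

end Spanning

section LinearChange

variable {K : Type*} [Field K] {ι : Type*} [Fintype ι] [DecidableEq ι]

/-- The linear change of coordinates `X_i ↦ ∑ j, M i j X_j` attached to an invertible matrix. -/
noncomputable def matrixAlgEquiv (M : Matrix ι ι K) (hM : IsUnit M.det) :
    MvPolynomial ι K ≃ₐ[K] MvPolynomial ι K :=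
  AlgEquiv.ofAlgHom (aeval fun i => ∑ j, C (M i j) * X j)
    (aeval fun i => ∑ j, C (M⁻¹ i j) * X j)
    (by
      ext i : 1
      simp only [AlgHom.comp_apply, aeval_X, map_sum, map_mul, algHom_C, AlgHom.id_apply,
        algebraMap_eq, Finset.mul_sum]
      rw [Finset.sum_comm]
      simp_rw [← mul_assoc, ← C_mul, ← Finset.sum_mul, ← map_sum, ← Matrix.mul_apply,
        Matrix.nonsing_inv_mul _ hM, Matrix.one_apply]
      simp)
    (by
      ext i : 1
      simp only [AlgHom.comp_apply, aeval_X, map_sum, map_mul, algHom_C, AlgHom.id_apply,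
        algebraMap_eq, Finset.mul_sum]
      rw [Finset.sum_comm]
      simp_rw [← mul_assoc, ← C_mul, ← Finset.sum_mul, ← map_sum, ← Matrix.mul_apply,
        Matrix.mul_nonsing_inv _ hM, Matrix.one_apply]
      simp)

theorem matrixAlgEquiv_X (M : Matrix ι ι K) (hM : IsUnit M.det) (i : ι) :
    matrixAlgEquiv M hM (X i) = ∑ j, C (M i j) * X j := by
  simp [matrixAlgEquiv]

end LinearChange

section Tangent

variable {K : Type*} [Field K]

theorem derivative_aeval_eq_sum {ι : Type*} [Fintype ι] (u : ι → Polynomial K)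
    (f : MvPolynomial ι K) :
    Polynomial.derivative (aeval u f) =
      ∑ l, Polynomial.derivative (u l) * aeval u (pderiv l f) := by
  classical
  induction f using MvPolynomial.induction_on with
  | C a => simp [algHom_C, Polynomial.algebraMap_eq]
  | add p q hp hq => simp only [map_add, hp, hq, mul_add, Finset.sum_add_distrib]
  | mul_X p i hp =>
    simp only [map_mul, aeval_X, Polynomial.derivative_mul, hp, Derivation.leibniz, pderiv_X,
      smul_eq_mul, map_add, mul_add, Finset.sum_add_distrib]
    rw [add_comm, Finset.sum_mul]
    congr 1
    · rw [Finset.sum_eq_single i]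
      · simp; ring
      · intro j _ hj
        simp [hj.symm]
      · simp
    · exact Finset.sum_congr rfl fun j _ => by ring

/-- The velocity at `t = 0` of a polynomial curve in the zero locus of `I` is tangent. -/
theorem coeff_one_mem_jacTangentSpace {ι : Type*} [Fintype ι] {I : Ideal (MvPolynomial ι K)}
    {u : ι → Polynomial K} (hu : ∀ f ∈ I, aeval u f = 0) {p v : ι → K}
    (hp : ∀ l, (u l).coeff 0 = p l) (hv : ∀ l, (u l).coeff 1 = v l) :
    v ∈ jacTangentSpace I p := by
  intro f hf
  have h1 := derivative_aeval_eq_sum u f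
  rw [hu f hf, map_zero] at h1
  have h2 := congrArg (Polynomial.eval 0) h1
  rw [Polynomial.eval_zero, Polynomial.eval_finsetSum] at h2
  rw [h2]
  refine Finset.sum_congr rfl fun l _ => ?_
  have h3 : ∀ g : MvPolynomial ι K, Polynomial.eval 0 (aeval u g) = eval p g := by
    intro g
    have : (Polynomial.aeval (0 : K)).comp (aeval u) = aeval p := by
      ext i : 1
      simp [← hp i, Polynomial.coeff_zero_eq_eval_zero]
    have := DFunLike.congr_fun this g
    simpa [Polynomial.aeval_def, aeval_eq_eval] using this
  rw [Polynomial.eval_mul, h3, ← hv l, ← Polynomial.coeff_zero_eq_eval_zero,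
    Polynomial.coeff_derivative]
  simp

end Tangent

theorem conePar_eval₂ {K B : Type*} [Field K] [CommRing B] [Algebra K B] {e : ℕ}
    (p : Fin (e + 1) → Polynomial K) (ρ : Polynomial K →ₐ[K] B) (z : B)
    (f : MvPolynomial (Fin (e + 1)) K) :
    Polynomial.eval₂ (ρ : Polynomial K →+* B) z (conePar p f) =
      aeval (fun l => ρ (p l) * z) f := by
  induction f using MvPolynomial.induction_on with
  | C a =>
    rw [algHom_C, algHom_C, Polynomial.algebraMap_apply, Polynomial.eval₂_C]
    exact ρ.commutes a
  | add f g hf hg => rw [map_add, Polynomial.eval₂_add, hf, hg, map_add]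
  | mul_X f i hf =>
    rw [map_mul, Polynomial.eval₂_mul, hf, map_mul, aeval_X, conePar, aeval_X,
      Polynomial.eval₂_mul, Polynomial.eval₂_C, Polynomial.eval₂_X]
    rfl

namespace CentralArrangement

variable {K : Type*} [Field K]

theorem formDet_relation {ι : Type*} [Fintype ι] (A : CentralArrangement K ι 2)
    (x : Fin 2 → K) (i j k : ι) :
    A.formDet j k * A.formEval x i + A.formDet k i * A.formEval x j +
      A.formDet i j * A.formEval x k = 0 := by
  simp only [formDet, formEval]
  ring

theorem exists_formEval_eq {ι : Type*} [Fintype ι] (A : CentralArrangement K ι 2)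
    {i k : ι} (hik : i ≠ k) (a b : K) :
    ∃ x : Fin 2 → K, A.formEval x i = a ∧ A.formEval x k = b := by
  have hd := A.formDet_ne_zero hik
  refine ⟨![(a * A.form k 1 - b * A.form i 1) / A.formDet i k,
    (b * A.form i 0 - a * A.form k 0) / A.formDet i k], ?_, ?_⟩
  · simp only [formEval, Matrix.cons_val_zero, Matrix.cons_val_one]
    field_simp
    rw [formDet]
    ring
  · simp only [formEval, Matrix.cons_val_zero, Matrix.cons_val_one]
    field_simp
    rw [formDet]
    ring

section Point

variable {ι : Type*} [Fintype ι] [DecidableEq ι] (A : CentralArrangement K ι 2) {p : ι → K}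

theorem threeRelation_eval (hp : ∀ f ∈ A.otIdeal, eval p f = 0) {i j k : ι}
    (hij : i ≠ j) (hik : i ≠ k) (hjk : j ≠ k) :
    A.formDet j k * (p j * p k) + A.formDet k i * (p i * p k) +
      A.formDet i j * (p i * p j) = 0 := by
  have := hp _ (A.threeRelation_mem hij hik hjk)
  simpa using this

theorem threeRelation_tangent {v : ι → K} (hv : v ∈ jacTangentSpace A.otIdeal p) {i j k : ι}
    (hij : i ≠ j) (hik : i ≠ k) (hjk : j ≠ k) :
    A.formDet j k * (v j * p k + p j * v k) + A.formDet k i * (v i * p k + p i * v k) +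
      A.formDet i j * (v i * p j + p i * v j) = 0 := by
  have h1 : ∀ (c : K) (a b : ι), ∑ l, v l * eval p (pderiv l (C c * (X a * X b))) =
      c * (v a * p b + p a * v b) := by
    intro c a b
    simp only [Derivation.leibniz, pderiv_X, pderiv_C, smul_eq_mul, map_add, map_mul,
      eval_X, eval_C, Pi.single_apply, apply_ite (eval p), map_zero, mul_add, add_zero,
      Finset.sum_add_distrib, mul_ite, mul_one, mul_zero, Finset.sum_ite_eq,
      Finset.mem_univ, if_true]
    ring
  have h2 := hv _ (A.threeRelation_mem hij hik hjk)
  simp only [map_add, mul_add, Finset.sum_add_distrib] at h2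
  rw [h1, h1, h1] at h2
  exact h2

theorem mul_formEval_eq (hp : ∀ f ∈ A.otIdeal, eval p f = 0) {i k : ι} (hik : i ≠ k)
    {x : Fin 2 → K} (hi : A.formEval x i = p k) (hk : A.formEval x k = p i) (j : ι) :
    p j * A.formEval x j = p i * p k := by
  by_cases hij : i = j
  · rw [← hij, hi]
  by_cases hjk : j = k
  · rw [hjk, hk, mul_comm]
  have h1 := A.threeRelation_eval hp hij hik hjk
  have h2 := A.formDet_relation x i j k
  rw [hi, hk] at h2
  refine mul_left_cancel₀ (A.formDet_ne_zero hik.symm) ?_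
  linear_combination p j * h2 - h1

theorem formEval_ne_zero (hp : ∀ f ∈ A.otIdeal, eval p f = 0) {i k : ι} (hik : i ≠ k)
    (hpk : p k ≠ 0) {x : Fin 2 → K} (hi : A.formEval x i = p k) (hk : A.formEval x k = p i)
    {j : ι} (hjk : j ≠ k) : A.formEval x j ≠ 0 := by
  by_cases hij : i = j
  · rwa [← hij, hi]
  intro h0
  have h1 := A.mul_formEval_eq hp hik hi hk j
  rw [h0, mul_zero] at h1
  have hpi : p i = 0 := (mul_eq_zero.1 h1.symm).resolve_right hpk
  have h2 := A.formDet_relation x i j k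
  rw [hi, hk, h0, hpi, mul_zero, mul_zero, add_zero, add_zero] at h2
  exact (mul_ne_zero (A.formDet_ne_zero hjk) hpk) h2

theorem finrank_jacTangentSpace_le (hp : ∀ f ∈ A.otIdeal, eval p f = 0) {i k : ι} (hik : i ≠ k)
    (hpk : p k ≠ 0) : Module.finrank K (jacTangentSpace A.otIdeal p) ≤ 2 := by
  obtain ⟨x, hi, hk⟩ := A.exists_formEval_eq hik (p k) (p i)
  let φ : jacTangentSpace A.otIdeal p →ₗ[K] K × K :=
    ((LinearMap.proj i).prod (LinearMap.proj k)).comp (jacTangentSpace A.otIdeal p).subtype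
  have hφ : Function.Injective φ := by
    rw [← LinearMap.ker_eq_bot, LinearMap.ker_eq_bot']
    rintro ⟨v, hv⟩ h0
    obtain ⟨hvi, hvk⟩ : v i = 0 ∧ v k = 0 := Prod.mk.inj h0
    refine Subtype.ext (funext fun j => ?_)
    change v j = 0
    by_cases hij : i = j
    · rwa [← hij]
    by_cases hjk : j = k
    · rwa [hjk]
    have h1 := A.threeRelation_tangent hv hij hik hjk
    have h2 := A.formDet_relation x i j k
    rw [hi, hk] at h2
    rw [hvi, hvk] at h1
    have h3 : A.formDet k i * A.formEval x j * v j = 0 := by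
      linear_combination v j * h2 - h1
    exact (mul_eq_zero.1 h3).resolve_left (mul_ne_zero (A.formDet_ne_zero hik.symm)
      (A.formEval_ne_zero hp hik hpk hi hk hjk))
  have := LinearMap.finrank_le_finrank_of_injective hφ
  simpa using this

end Point

variable {e : ℕ} (A : CentralArrangement K (Fin (e + 1)) 2)

theorem exists_eq_mul_prod_formEval {p : Fin (e + 1) → K}
    (hp : ∀ f ∈ A.otIdeal, eval p f = 0) {i k : Fin (e + 1)} (hik : i ≠ k) (hpk : p k ≠ 0) :
    ∃ x : Fin 2 → K, x ≠ 0 ∧ ∃ c : K, c ≠ 0 ∧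
      ∀ j, p j = c * ∏ l ∈ Finset.univ.erase j, A.formEval x l := by
  obtain ⟨x, hi, hk⟩ := A.exists_formEval_eq hik (p k) (p i)
  have hne : ∀ j, j ≠ k → A.formEval x j ≠ 0 := fun j =>
    A.formEval_ne_zero hp hik hpk hi hk
  have hQ : ∏ l ∈ Finset.univ.erase k, A.formEval x l ≠ 0 :=
    Finset.prod_ne_zero_iff.2 fun l hl => hne l (Finset.ne_of_mem_erase hl)
  refine ⟨x, ?_, p k / ∏ l ∈ Finset.univ.erase k, A.formEval x l, div_ne_zero hpk hQ, ?_⟩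
  · rintro rfl
    exact hpk (by rw [← hi]; simp [formEval])
  · intro j
    by_cases hjk : j = k
    · subst hjk
      field_simp
    · have h1 := A.mul_formEval_eq hp hik hi hk j
      have h2 := Finset.mul_prod_erase Finset.univ (A.formEval x) (Finset.mem_univ j)
      have h3 := Finset.mul_prod_erase Finset.univ (A.formEval x) (Finset.mem_univ k)
      rw [← h3, hk] at h2
      refine mul_right_cancel₀ (hne j hjk) ?_
      rw [h1, div_mul_eq_mul_div, div_mul_eq_mul_div, eq_div_iff hQ]
      linear_combination -p k * h2

theorem finrank_jacTangentSpace (he : 1 ≤ e) {p : Fin (e + 1) → K}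
    (hp : ∀ f ∈ A.otIdeal, eval p f = 0) (hp0 : p ≠ 0) :
    Module.finrank K (jacTangentSpace A.otIdeal p) = 2 := by
  have : Nontrivial (Fin (e + 1)) := Fin.nontrivial_iff_two_le.2 (by omega)
  obtain ⟨k, hpk⟩ := Function.ne_iff.1 hp0
  obtain ⟨i, hik⟩ := exists_ne k
  refine le_antisymm (A.finrank_jacTangentSpace_le hp hik hpk) ?_
  obtain ⟨x, hx, c, hc, hpc⟩ := A.exists_eq_mul_prod_formEval hp hik hpk
  obtain ⟨y, hxy⟩ : ∃ y : Fin 2 → K, x 0 * y 1 - x 1 * y 0 ≠ 0 := by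
    by_contra! h
    refine hx (funext fun l => ?_)
    fin_cases l
    · simpa using h ![0, 1]
    · simpa using h ![1, 0]
  set P := lineProd (A.formEval x) (A.formEval y) with hP
  have hI := A.otIdeal_le_ker he hxy
  have hcurve : ∀ (ρ : Polynomial K →ₐ[K] Polynomial K) (z : Polynomial K),
      ∀ f ∈ A.otIdeal, aeval (fun l => ρ (P l) * z) f = 0 := by
    intro ρ z f hf
    have h0 : conePar P f = 0 := hI hf
    rw [← conePar_eval₂, h0, Polynomial.eval₂_zero]
  have hP0 : ∀ l, (P l).coeff 0 * c = p l := by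
    intro l
    rw [hpc, Polynomial.coeff_zero_eq_eval_zero, hP, eval_lineProd]
    simp [mul_comm]
  have t0 : p ∈ jacTangentSpace A.otIdeal p := by
    have hz : ∀ q : Polynomial K,
        Polynomial.aeval (0 : Polynomial K) q = Polynomial.C (q.coeff 0) := by
      intro q
      rw [Polynomial.aeval_def, Polynomial.eval₂_at_zero, Polynomial.algebraMap_eq]
    refine coeff_one_mem_jacTangentSpace
      (hcurve (Polynomial.aeval 0) (Polynomial.C c * (1 + Polynomial.X))) ?_ ?_
    · intro l
      rw [hz, Polynomial.coeff_C_mul, Polynomial.coeff_C_mul, ← hP0]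
      simp
    · intro l
      rw [hz, Polynomial.coeff_C_mul, Polynomial.coeff_C_mul, ← hP0]
      simp [Polynomial.coeff_one]
  have t1 : (fun l => (P l).coeff 1 * c) ∈ jacTangentSpace A.otIdeal p := by
    refine coeff_one_mem_jacTangentSpace
      (hcurve (AlgHom.id K _) (Polynomial.C c)) ?_ ?_
    · intro l
      rw [← hP0]
      simp
    · intro l
      simp
  have hM := isUnit_lineProdMatrix (fun i j => A.formEval_det_ne_zero hxy (i := i) (j := j))
  have hcols := Matrix.linearIndependent_cols_iff_isUnit.2 hM
  have hli : LinearIndependent K ![(⟨p, t0⟩ : jacTangentSpace A.otIdeal p), ⟨_, t1⟩] := by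
    rw [LinearIndependent.pair_iff]
    intro s t hst
    have h1 : ∀ l, s * p l + t * ((P l).coeff 1 * c) = 0 := fun l =>
      congrFun (congrArg Subtype.val hst) l
    have hinj : Function.Injective ![(⟨0, by omega⟩ : Fin (e + 1)), ⟨1, by omega⟩] := by
      intro a b hab
      fin_cases a <;> fin_cases b <;> simp at hab ⊢
    have h2 := Fintype.linearIndependent_iff.1 (hcols.comp _ hinj) ![s, t] ?_
    · exact ⟨h2 0, h2 1⟩
    · ext l
      refine mul_left_cancel₀ hc ?_
      have := h1 l
      rw [← hP0] at this
      simp only [Fin.sum_univ_two, Function.comp_apply, Matrix.cons_val_zero,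
        Matrix.cons_val_one, Pi.add_apply, Pi.smul_apply, smul_eq_mul, Pi.zero_apply, mul_zero]
      change c * (s * (P l).coeff 0 + t * (P l).coeff 1) = 0
      linear_combination this
  simpa using hli.fintype_card_le_finrank

theorem eq_zero_of_mem_otIdeal_of_isHomogeneous_one (he : 1 ≤ e)
    {f : MvPolynomial (Fin (e + 1)) K} (hf : f ∈ A.otIdeal) (hf1 : f.IsHomogeneous 1) :
    f = 0 := by
  have hxy : (![1, 0] : Fin 2 → K) 0 * (![0, 1] : Fin 2 → K) 1 -
      (![1, 0] : Fin 2 → K) 1 * (![0, 1] : Fin 2 → K) 0 ≠ 0 := by simp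
  have h0 := aeval_eq_zero_of_le_ker_conePar (A.otIdeal_le_ker he hxy) hf
  have hmem : f ∈ homogeneousSubmodule (Fin (e + 1)) K 1 := hf1
  rw [homogeneousSubmodule_one_eq_span_X] at hmem
  obtain ⟨c, rfl⟩ := (Submodule.mem_span_range_iff_exists_fun K).1 hmem
  simp only [map_sum, map_smul, aeval_X] at h0
  have hli := linearIndependent_lineProd
    (fun i j => A.formEval_det_ne_zero hxy (i := i) (j := j))
  simp [Fintype.linearIndependent_iff.1 hli c h0]

end CentralArrangement

theorem map_ker_conePar_lineProd {K : Type*} [Field K] {e : ℕ} {u v : Fin (e + 1) → K}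
    (σ : MvPolynomial (Fin (e + 1)) K ≃ₐ[K] MvPolynomial (Fin (e + 1)) K)
    (hσ : ∀ i, σ (X i) = ∑ j, C (lineProdMatrix u v i j) * X j) :
    Ideal.map σ.toAlgHom.toRingHom
        (RingHom.ker (conePar (lineProd u v))) =
      RingHom.ker (conePar fun i : Fin (e + 1) => (Polynomial.X : Polynomial K) ^ (i : ℕ)) := by
  have hcomp : (conePar fun i : Fin (e + 1) => (Polynomial.X : Polynomial K) ^ (i : ℕ)).comp
      σ.toAlgHom = conePar (lineProd u v) := by
    ext i : 1
    have hX : σ.toAlgHom (X i) = σ (X i) := rfl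
    rw [AlgHom.comp_apply, hX, hσ, map_sum, conePar, conePar, aeval_X, lineProd_eq_sum, map_sum,
      Finset.sum_mul]
    refine Finset.sum_congr rfl fun j _ => ?_
    rw [map_mul, aeval_X, algHom_C, Polynomial.algebraMap_apply, Polynomial.algebraMap_eq,
      map_mul, mul_assoc]
  have hcomap : RingHom.ker (conePar (lineProd u v)) =
      Ideal.comap σ.toAlgHom.toRingHom (RingHom.ker
        (conePar fun i : Fin (e + 1) => (Polynomial.X : Polynomial K) ^ (i : ℕ))) := by
    ext f
    rw [Ideal.mem_comap, RingHom.mem_ker, RingHom.mem_ker, ← hcomp]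
    rfl
  rw [hcomap]
  exact Ideal.map_comap_of_surjective _ σ.surjective _

/-- Let `A` be an essential central arrangement of rank 2 consisting of
`d ≥ 4` hyperplanes, with Orlik-Terao ideal `I ⊆ R = K[y_1,…,y_d]`.  Then the projective
variety `V(I) ⊆ P^{d−1}` is a rational normal curve of degree `d − 1`: after a linear change
of coordinates, `I` becomes the ideal of 2×2 minors defining the standard rational normal
curve.  In particular it is a smooth (the tangent space of the affine cone at every nonzero
point of the cone has dimension 2, i.e. `dim T_p V(I) = 1`), irreducible (`I` is prime),
nondegenerate (`I` contains no nonzero linear form) curve of degree `d − 1` (its Hilbert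
polynomial is `(d−1)·m + c`). -/
theorem rank_two_otIdeal_rational_normal_curve
    (K : Type*) [Field K] (d : ℕ) (hd : 4 ≤ d)
    (A : CentralArrangement K (Fin d) 2) :
    (∃ σ : MvPolynomial (Fin d) K ≃ₐ[K] MvPolynomial (Fin d) K,
      (∀ i, (σ (X i)).IsHomogeneous 1) ∧
      Ideal.map σ.toAlgHom.toRingHom A.otIdeal =
        Ideal.span {g : MvPolynomial (Fin d) K | ∃ i j : ℕ,
          ∃ (hi : i + 1 < d) (hj : j + 1 < d),
          g = X ⟨i, by omega⟩ * X ⟨j + 1, hj⟩ - X ⟨i + 1, hi⟩ * X ⟨j, by omega⟩}) ∧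
    A.otIdeal.IsPrime ∧
    (∀ f ∈ A.otIdeal, f.IsHomogeneous 1 → f = 0) ∧
    (∃ c : ℤ, ∀ m : ℕ, 1 ≤ m →
      (Module.finrank K ↥(quotGradedPiece A.otIdeal m) : ℤ) = (d - 1 : ℤ) * m + c) ∧
    (∀ p : Fin d → K, (∀ f ∈ A.otIdeal, eval p f = 0) → p ≠ 0 →
      Module.finrank K ↥(jacTangentSpace A.otIdeal p) = 2) := by
  obtain ⟨e, rfl⟩ : ∃ e, d = e + 1 := ⟨d - 1, by omega⟩
  have he : 1 ≤ e := by omega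
  have hxy : (![1, 0] : Fin 2 → K) 0 * (![0, 1] : Fin 2 → K) 1 -
      (![1, 0] : Fin 2 → K) 1 * (![0, 1] : Fin 2 → K) 0 ≠ 0 := by simp
  have hdet := fun i j => A.formEval_det_ne_zero hxy (i := i) (j := j)
  have hM := (Matrix.isUnit_iff_isUnit_det _).1 (isUnit_lineProdMatrix hdet)
  have hI := A.otIdeal_eq_ker he hxy
  refine ⟨⟨matrixAlgEquiv _ hM, fun i => ?_, ?_⟩, ?_,
    fun f hf hf1 => A.eq_zero_of_mem_otIdeal_of_isHomogeneous_one he hf hf1, ⟨1, fun m _ => ?_⟩,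
    fun p hp hp0 => A.finrank_jacTangentSpace he hp hp0⟩
  · rw [matrixAlgEquiv_X]
    exact IsHomogeneous.sum _ _ _ fun j _ => isHomogeneous_C_mul_X _ _
  · rw [hI, map_ker_conePar_lineProd _ (matrixAlgEquiv_X _ hM), ← minorIdeal_eq_ker he]
    rfl
  · rw [hI]
    exact RingHom.ker_isPrime _
  · rw [finrank_quotGradedPiece (fun _ hw => X_pow_mem_span_lineProd hdet hw) hI.le
      (starMonomial K e) starMonomial_isHomogeneous A.homogeneousSubmodule_le m]
    push_cast
    ring
end

section
/- Let A be an essential central arrangement of rank 2 consisting of d ≥ 4 hyperplanes, with Orlik–Terao ideal I ⊆ R = K[y_1,…,y_d]. Then ⟨I, y_d⟩ = ⟨J, y_d⟩ where J = ⟨ y_i y_j : 1 ≤ i < j ≤ d−1 ⟩, the primary decomposition of ⟨I, y_d⟩ is ⟨I, y_d⟩ = ⋂_{1 ≤ i_1 < ⋯ < i_{d−2} ≤ d−1} ⟨ y_{i_1},…,y_{i_{d−2}}, y_d ⟩, and consequently the degree of V(⟨I, y_d⟩) equals d − 1. -/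
open MvPolynomial

open MvPolynomial

/-- The monomial ideal generated by `y_z` and all products `y_i y_j` of two distinct variables
other than `y_z`. -/
noncomputable def crossIdeal (K : Type*) [Field K] {ι : Type*} (z : ι) :
    Ideal (MvPolynomial ι K) :=
  Ideal.span {g | ∃ i j : ι, i ≠ j ∧ i ≠ z ∧ j ≠ z ∧ g = X i * X j} ⊔ Ideal.span {X z}

section CrossIdeal

variable {K : Type*} [Field K] {ι : Type*} {z : ι}

theorem X_mem_crossIdeal : (X z : MvPolynomial ι K) ∈ crossIdeal K z :=
  Ideal.mem_sup_right (Ideal.mem_span_singleton_self _)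

theorem X_mul_X_mem_crossIdeal {i j : ι} (hij : i ≠ j) :
    (X i * X j : MvPolynomial ι K) ∈ crossIdeal K z := by
  by_cases hi : i = z
  · subst hi
    exact Ideal.mul_mem_right _ _ X_mem_crossIdeal
  by_cases hj : j = z
  · subst hj
    exact Ideal.mul_mem_left _ _ X_mem_crossIdeal
  exact Ideal.mem_sup_left (Ideal.subset_span ⟨i, j, hij, hi, hj, rfl⟩)

theorem mem_crossIdeal_iff [DecidableEq ι] {f : MvPolynomial ι K} :
    f ∈ crossIdeal K z ↔
      ∀ e ∈ f.support, e z ≠ 0 ∨ ∃ i j : ι, i ≠ j ∧ i ≠ z ∧ j ≠ z ∧ e i ≠ 0 ∧ e j ≠ 0 := by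
  have h : crossIdeal K z = Ideal.span ((fun s => monomial s (1 : K)) ''
      ({s | ∃ i j : ι, i ≠ j ∧ i ≠ z ∧ j ≠ z ∧ s = Finsupp.single i 1 + Finsupp.single j 1} ∪
        {Finsupp.single z 1})) := by
    rw [crossIdeal, ← Ideal.span_union, Set.image_union, Set.image_singleton]
    congr 2
    ext g
    constructor
    · rintro ⟨i, j, h1, h2, h3, rfl⟩
      exact ⟨_, ⟨i, j, h1, h2, h3, rfl⟩, by simp [X, monomial_mul]⟩
    · rintro ⟨_, ⟨i, j, h1, h2, h3, rfl⟩, rfl⟩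
      exact ⟨i, j, h1, h2, h3, by simp [X, monomial_mul]⟩
  rw [h, mem_ideal_span_monomial_image]
  refine forall₂_congr fun e _ => ?_
  constructor
  · rintro ⟨s, ⟨i, j, h1, h2, h3, rfl⟩ | rfl, hs⟩
    · refine Or.inr ⟨i, j, h1, h2, h3, ?_, ?_⟩
      · have := hs i
        simp at this
        omega
      · have := hs j
        simp at this
        omega
    · have := hs z
      simp at this
      exact Or.inl (by omega)
  · rintro (hz | ⟨i, j, h1, h2, h3, hi, hj⟩)
    · exact ⟨_, Or.inr rfl, by simpa [Nat.one_le_iff_ne_zero] using hz⟩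
    · refine ⟨_, Or.inl ⟨i, j, h1, h2, h3, rfl⟩, fun k => ?_⟩
      by_cases hki : i = k
      · subst hki
        simp [h1.symm]
        omega
      · by_cases hkj : j = k
        · subst hkj
          simp [h1]
          omega
        · simp [hki, hkj]

theorem prod_X_mem_crossIdeal {s : Finset ι} (hs : 2 ≤ s.card) :
    (∏ l ∈ s, X l : MvPolynomial ι K) ∈ crossIdeal K z := by
  classical
  obtain ⟨a, ha, b, hb, hab⟩ := Finset.one_lt_card.mp hs
  rw [← Finset.mul_prod_erase s _ ha,
    ← Finset.mul_prod_erase (s.erase a) _ (Finset.mem_erase.mpr ⟨hab.symm, hb⟩), ← mul_assoc]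
  exact Ideal.mul_mem_right _ _ (X_mul_X_mem_crossIdeal hab)

theorem crossIdeal_eq_iInf [Fintype ι] [DecidableEq ι] {n : ℕ} (hn : Fintype.card ι = n)
    (h2 : 2 ≤ n) :
    crossIdeal K z =
      ⨅ T : {T : Finset ι // T.card = n - 2 ∧ z ∉ T},
        Ideal.span {g : MvPolynomial ι K | (∃ i ∈ T.1, g = X i) ∨ g = X z} := by
  ext f
  have hspan (T : Finset ι) : {g : MvPolynomial ι K | (∃ i ∈ T, g = X i) ∨ g = X z} =
      X '' ((insert z T : Finset ι) : Set ι) := by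
    ext g
    simp [eq_comm, or_comm]
  simp only [Ideal.mem_iInf, hspan, mem_ideal_span_X_image, mem_crossIdeal_iff]
  constructor
  · rintro h ⟨T, hT, hzT⟩ e he
    rcases h e he with hz | ⟨i, j, hij, hi, hj, hei, hej⟩
    · exact ⟨z, by simp, hz⟩
    by_contra! hcon
    have hiT : i ∉ T := fun hmem => hei (hcon i (by simp [hmem]))
    have hjT : j ∉ T := fun hmem => hej (hcon j (by simp [hmem]))
    have hc := Finset.card_le_univ (insert i (insert j (insert z T)))
    rw [Finset.card_insert_of_notMem (by simp [hij, hi, hiT]),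
      Finset.card_insert_of_notMem (by simp [hj, hjT]),
      Finset.card_insert_of_notMem hzT] at hc
    omega
  · intro h e he
    by_cases hz : e z = 0
    swap
    · exact Or.inl hz
    have key (k : ι) (hk : k ≠ z) : ∃ i, i ≠ k ∧ i ≠ z ∧ e i ≠ 0 := by
      obtain ⟨i, hi, hei⟩ := h ⟨(Finset.univ.erase z).erase k, by
        rw [Finset.card_erase_of_mem (by simp [hk]), Finset.card_erase_of_mem (by simp),
          Finset.card_univ]
        omega, by simp⟩ e he
      have hiz : i ≠ z := by
        rintro rfl
        exact hei hz
      refine ⟨i, ?_, hiz, hei⟩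
      simpa [hiz] using hi
    have : Nontrivial ι := Fintype.one_lt_card_iff_nontrivial.mp (by omega)
    obtain ⟨k, hk⟩ := exists_ne z
    obtain ⟨i, -, hiz, hei⟩ := key k hk
    obtain ⟨j, hji, hjz, hej⟩ := key i hiz
    exact Or.inr ⟨i, j, hji.symm, hiz, hjz, hei, hej⟩

theorem finrank_quotGradedPiece_crossIdeal [Fintype ι] [DecidableEq ι] {m : ℕ} (hm : 1 ≤ m) :
    Module.finrank K (quotGradedPiece (crossIdeal K z) m) = Fintype.card ι - 1 := by
  let p : ({i : ι // i ≠ z} → K) →ₗ[K] MvPolynomial ι K :=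
    ∑ i, (monomial (Finsupp.single i.1 m)).comp (LinearMap.proj i)
  have hp (c : {i : ι // i ≠ z} → K) : p c = ∑ i, monomial (Finsupp.single i.1 m) (c i) := by
    simp [p]
  have hcoeff (c : {i : ι // i ≠ z} → K) (i : {i : ι // i ≠ z}) :
      coeff (Finsupp.single i.1 m) (p c) = c i := by
    rw [hp, coeff_sum, Finset.sum_eq_single i]
    · simp
    · intro j _ hj
      rw [coeff_monomial, if_neg]
      intro h
      exact hj (Subtype.ext (Finsupp.single_left_injective (by omega) h))
    · simp
  let g := (Ideal.Quotient.mkₐ K (crossIdeal K z)).toLinearMap.comp p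
  have hg : Function.Injective g := by
    rw [injective_iff_map_eq_zero]
    intro c hc
    have hmem : p c ∈ crossIdeal K z := Ideal.Quotient.eq_zero_iff_mem.mp hc
    rw [mem_crossIdeal_iff] at hmem
    ext i
    by_contra hci
    rcases hmem (Finsupp.single i.1 m) (by rwa [mem_support_iff, hcoeff]) with
      h | ⟨a, b, hab, -, -, ha, hb⟩
    · simp [i.2] at h
    · simp only [Finsupp.single_apply] at ha hb
      grind
  have hrange : LinearMap.range g = quotGradedPiece (crossIdeal K z) m := by
    apply le_antisymm
    · rintro _ ⟨c, rfl⟩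
      refine ⟨p c, ?_, rfl⟩
      rw [hp]
      refine Submodule.sum_mem _ fun i _ => ?_
      exact isHomogeneous_monomial _ (by simp)
    · rintro _ ⟨f, hf, rfl⟩
      refine ⟨fun i => coeff (Finsupp.single i.1 m) f, ?_⟩
      refine Ideal.Quotient.eq.mpr ?_
      rw [mem_crossIdeal_iff]
      intro e he
      by_contra! hcon
      obtain ⟨hez, hcon⟩ := hcon
      have hhom : (p (fun i => coeff (Finsupp.single i.1 m) f) - f).IsHomogeneous m := by
        refine Submodule.sub_mem (homogeneousSubmodule ι K m) ?_ hf
        rw [hp]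
        refine Submodule.sum_mem _ fun i _ => ?_
        exact isHomogeneous_monomial _ (by simp)
      have hdeg : e.degree = m := by
        by_contra hne
        exact (mem_support_iff.mp he) (hhom.coeff_eq_zero hne)
      have hne : e ≠ 0 := by
        rintro rfl
        simp at hdeg
        omega
      obtain ⟨i, hi⟩ := Finsupp.ne_iff.mp hne
      have hi' : e i ≠ 0 := by simpa using hi
      have hiz : i ≠ z := by
        rintro rfl
        exact hi' hez
      have heq : e = Finsupp.single i (e i) := by
        ext j
        rw [Finsupp.single_apply]
        split_ifs with hij
        · rw [hij]
        · by_cases hjz : j = z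
          · rw [hjz, hez]
          · exact hcon i j hij hiz hjz hi'
      have him : e i = m := by
        rw [heq] at hdeg
        simpa using hdeg
      rw [him] at heq
      rw [mem_support_iff, coeff_sub, heq, hcoeff _ ⟨i, hiz⟩] at he
      simp at he
  rw [← hrange, LinearMap.finrank_range_of_inj hg, Module.finrank_fintype_fun_eq_card,
    Fintype.card_subtype_compl, Fintype.card_subtype_eq]

end CrossIdeal

namespace CentralArrangement

variable {K : Type*} [Field K] {ι : Type*} [Fintype ι]

theorem mem_relSpace_iff {n : ℕ} (A : CentralArrangement K ι n) {c : ι → K} :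
    c ∈ A.relSpace ↔ ∑ i, c i • A.form i = 0 :=
  Iff.rfl

theorem two_lt_card_vsupp {n : ℕ} (A : CentralArrangement K ι n) {c : ι → K}
    (hc : c ∈ A.relSpace) {i : ι} (hi : i ∈ vsupp c) : 2 < (vsupp c).card := by
  have hsum : ∑ l ∈ vsupp c, c l • A.form l = 0 := by
    rw [← A.mem_relSpace_iff.mp hc]
    refine Finset.sum_subset (Finset.subset_univ _) fun l _ hl => ?_
    have : c l = 0 := by simpa [vsupp] using hl
    simp [this]
  have hci : c i ≠ 0 := by simpa [vsupp] using hi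
  classical
  by_contra! hle
  rw [← Finset.add_sum_erase _ _ hi] at hsum
  have hcard := Finset.card_erase_of_mem hi
  rcases Finset.eq_empty_or_nonempty ((vsupp c).erase i) with he | ⟨j, hj⟩
  · rw [he, Finset.sum_empty, add_zero] at hsum
    exact (smul_ne_zero hci (A.nonzero i)) hsum
  · have he : (vsupp c).erase i = {j} := by
      refine (Finset.eq_of_subset_of_card_le (by simpa using hj) ?_).symm
      simp
      omega
    rw [he, Finset.sum_singleton] at hsum
    refine A.nonProportional i j (Finset.ne_of_mem_erase hj).symm (-((c i)⁻¹ * c j)) ?_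
    have := congrArg (fun v => (c i)⁻¹ • v) (eq_neg_of_add_eq_zero_left hsum)
    simpa [smul_smul, hci] using this

theorem otgen_mem_crossIdeal [DecidableEq ι] {n : ℕ} (A : CentralArrangement K ι n) {c : ι → K}
    (hc : c ∈ A.relSpace) (z : ι) : otgen c ∈ crossIdeal K z := by
  refine Ideal.sum_mem _ fun j hj => Ideal.mul_mem_left _ _ (prod_X_mem_crossIdeal ?_)
  have := A.two_lt_card_vsupp hc hj
  rw [Finset.card_erase_of_mem hj]
  omega

/-- The `2 × 2` minor of the coefficient vectors of two hyperplanes. -/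
def minor (A : CentralArrangement K ι 2) (i j : ι) : K :=
  A.form i 0 * A.form j 1 - A.form i 1 * A.form j 0

theorem minor_ne_zero (A : CentralArrangement K ι 2) {i j : ι} (hij : i ≠ j) :
    A.minor i j ≠ 0 := by
  intro h
  rw [minor] at h
  by_cases h0 : A.form j 0 = 0
  · by_cases h1 : A.form j 1 = 0
    · exact A.nonzero j (by ext k; fin_cases k <;> simp [h0, h1])
    · refine A.nonProportional i j hij (A.form i 1 / A.form j 1) ?_
      ext k
      fin_cases k
      · simp_all
      · simp [h1]
  · refine A.nonProportional i j hij (A.form i 0 / A.form j 0) ?_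
    ext k
    fin_cases k
    · simp [h0]
    · simp
      field_simp
      linear_combination -h

theorem exists_three_relation [DecidableEq ι] (A : CentralArrangement K ι 2) {i j k : ι}
    (hij : i ≠ j) (hik : i ≠ k) (hjk : j ≠ k) :
    ∃ c ∈ A.relSpace, vsupp c = {i, j, k} := by
  refine ⟨Pi.single i (A.minor j k) + Pi.single j (A.minor k i) + Pi.single k (A.minor i j),
    ?_, ?_⟩
  · rw [mem_relSpace_iff]
    simp only [Pi.add_apply, add_smul, Finset.sum_add_distrib, Pi.single_apply, ite_smul,
      zero_smul, Finset.sum_ite_eq', Finset.mem_univ, if_true]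
    ext l
    fin_cases l <;> simp [minor] <;> ring
  · ext l
    have h1 := A.minor_ne_zero hij
    have h2 := A.minor_ne_zero hjk
    have h3 := A.minor_ne_zero hik.symm
    simp only [vsupp, Finset.mem_filter, Finset.mem_univ, true_and, Finset.mem_insert,
      Finset.mem_singleton, Pi.add_apply, Pi.single_apply]
    by_cases hli : l = i
    · subst hli
      simp [hij, hik, h2]
    by_cases hlj : l = j
    · subst hlj
      simp [hij.symm, hjk, h3]
    by_cases hlk : l = k
    · subst hlk
      simp [hik.symm, hjk.symm, h1]
    simp [hli, hlj, hlk]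

theorem otIdeal_sup_span_X_eq_crossIdeal [DecidableEq ι] (A : CentralArrangement K ι 2)
    (z : ι) :
    A.otIdeal ⊔ Ideal.span {X z} = crossIdeal K z := by
  apply le_antisymm
  · refine sup_le ?_ le_sup_right
    refine Ideal.span_le.mpr ?_
    rintro _ ⟨c, hc, rfl⟩
    exact A.otgen_mem_crossIdeal hc z
  · refine sup_le (Ideal.span_le.mpr ?_) le_sup_right
    rintro _ ⟨i, j, hij, hi, hj, rfl⟩
    obtain ⟨c, hc, hsupp⟩ := A.exists_three_relation hij hi hj
    have hz : (X z : MvPolynomial ι K) ∈ A.otIdeal ⊔ Ideal.span {X z} :=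
      Ideal.mem_sup_right (Ideal.mem_span_singleton_self _)
    have hgen : otgen c ∈ A.otIdeal ⊔ Ideal.span {X z} :=
      Ideal.mem_sup_left (Ideal.subset_span ⟨c, hc, rfl⟩)
    have hcz : c z ≠ 0 := by
      have : z ∈ vsupp c := by simp [hsupp]
      simpa [vsupp] using this
    have hexp : otgen c =
        C (c i) * (X j * X z) + (C (c j) * (X i * X z) + C (c z) * (X i * X j)) := by
      have e1 : ({i, j, z} : Finset ι).erase i = {j, z} := by grind
      have e2 : ({i, j, z} : Finset ι).erase j = {i, z} := by grind
      have e3 : ({i, j, z} : Finset ι).erase z = {i, j} := by grind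
      rw [otgen, hsupp, Finset.sum_insert (by simp [hij, hi]), Finset.sum_pair hj, e1, e2, e3,
        Finset.prod_pair hj, Finset.prod_pair hi, Finset.prod_pair hij]
    have hdecomp : (X i * X j : MvPolynomial ι K) =
        C (c z)⁻¹ * otgen c - C (c z)⁻¹ * (C (c i) * X j + C (c j) * X i) * X z := by
      have hC : (C (c z)⁻¹ * C (c z) : MvPolynomial ι K) = 1 := by
        rw [← C_mul, inv_mul_cancel₀ hcz, C_1]
      rw [hexp]
      linear_combination -(X i * X j) * hC
    rw [hdecomp]
    exact Ideal.sub_mem _ (Ideal.mul_mem_left _ _ hgen) (Ideal.mul_mem_left _ _ hz)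

end CentralArrangement

/-- Let `A` be an essential central arrangement of rank 2 consisting of
`d ≥ 4` hyperplanes, with Orlik-Terao ideal `I ⊆ R = K[y_1,…,y_d]`.  Then
`⟨I, y_d⟩ = ⟨J, y_d⟩` where `J = ⟨y_i y_j : 1 ≤ i < j ≤ d−1⟩`; the primary decomposition of
`⟨I, y_d⟩` is the intersection of the monomial primes `⟨y_{i_1},…,y_{i_{d−2}}, y_d⟩` over all
`(d−2)`-subsets `{i_1,…,i_{d−2}}` of `{1,…,d−1}`; and consequently the degree of
`V(⟨I, y_d⟩)` equals `d − 1` (its Hilbert function is eventually the constant `d − 1`). -/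
theorem rank_two_otIdeal_plus_last_variable
    (K : Type*) [Field K] (d : ℕ) (hd : 4 ≤ d)
    (A : CentralArrangement K (Fin d) 2) :
    (A.otIdeal ⊔ Ideal.span {X ⟨d - 1, by omega⟩} =
      Ideal.span {g : MvPolynomial (Fin d) K |
          ∃ i j : Fin d, i < j ∧ j ≠ ⟨d - 1, by omega⟩ ∧ g = X i * X j} ⊔
        Ideal.span {X ⟨d - 1, by omega⟩}) ∧
    (A.otIdeal ⊔ Ideal.span {X ⟨d - 1, by omega⟩} =
      ⨅ T : {T : Finset (Fin d) // T.card = d - 2 ∧ (⟨d - 1, by omega⟩ : Fin d) ∉ T},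
        Ideal.span {g : MvPolynomial (Fin d) K |
          (∃ i ∈ T.1, g = X i) ∨ g = X ⟨d - 1, by omega⟩}) ∧
    (∃ N : ℕ, ∀ m : ℕ, N ≤ m →
      Module.finrank K
        ↥(quotGradedPiece (A.otIdeal ⊔ Ideal.span {X ⟨d - 1, by omega⟩}) m) = d - 1) := by
  rw [A.otIdeal_sup_span_X_eq_crossIdeal]
  refine ⟨?_, ?_, 1, fun m hm => ?_⟩
  · rw [crossIdeal]
    congr 2
    ext g
    constructor
    · rintro ⟨i, j, hij, hi, hj, rfl⟩
      rcases lt_or_gt_of_ne hij with h | h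
      · exact ⟨i, j, h, hj, rfl⟩
      · exact ⟨j, i, h, hi, mul_comm _ _⟩
    · rintro ⟨i, j, hij, hj, rfl⟩
      refine ⟨i, j, hij.ne, ?_, hj, rfl⟩
      rintro rfl
      have := Fin.lt_def.mp hij
      simp only at this
      omega
  · exact crossIdeal_eq_iInf (Fintype.card_fin d) (by omega)
  · rw [finrank_quotGradedPiece_crossIdeal hm, Fintype.card_fin]
end

section
/- Let G be a simple graph and let I_G be the Orlik–Terao ideal of the graphic arrangement A_G. Then I_G is minimally generated by the elements ∂(r_C) as C ranges over the chordless cycles of G (cycles with no chord, i.e. induced cycles). -/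
open MvPolynomial

section GraphicArrangement

variable (K : Type*) [Field K] {V : Type*} [Fintype V] [DecidableEq V]
variable (G : SimpleGraph V) [DecidableRel G.Adj]

/-- The defining linear form `z_i − z_j` of the hyperplane of the graphic arrangement `A_G`
corresponding to the edge `e = {i, j}` (for a fixed choice of orientation of `e`). -/
noncomputable def graphForm (e : G.edgeSet) : V → K :=
  Pi.single (Quot.out (e : Sym2 V)).1 (1 : K) -
    Pi.single (Quot.out (e : Sym2 V)).2 (1 : K)

/-- The evaluation map `K^{E(G)} → K^V` of the graphic arrangement, `e ↦ z_i − z_j`. -/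
noncomputable def graphEvalMap : (G.edgeSet → K) →ₗ[K] (V → K) where
  toFun c := ∑ e, c e • graphForm K G e
  map_add' x y := by
    simp [add_smul, Finset.sum_add_distrib]
  map_smul' t x := by
    simp [smul_smul, Finset.smul_sum]

/-- The relation space of the graphic arrangement `A_G`. -/
noncomputable def graphRelSpace : Submodule K (G.edgeSet → K) :=
  LinearMap.ker (graphEvalMap K G)

/-- The Orlik-Terao ideal `I_G` of the graphic arrangement `A_G`, in the polynomial ring
`K[y_e : e ∈ E(G)]`. -/
noncomputable def graphOTIdeal : Ideal (MvPolynomial G.edgeSet K) :=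
  Ideal.span (otgen '' (graphRelSpace K G : Set (G.edgeSet → K)))

end GraphicArrangement


/-- A finset `S` of edges of `G` is the edge set of a chordless (induced) cycle of `G`:
there is a cycle of `G` with edge set `S` such that any edge of `G` joining two vertices
of the cycle is an edge of the cycle. -/
def IsChordlessCycleEdges {V : Type*} [Fintype V] [DecidableEq V]
    (G : SimpleGraph V) [DecidableRel G.Adj] (S : Finset G.edgeSet) : Prop :=
  ∃ (v : V) (w : G.Walk v v), w.IsCycle ∧
    (∀ x ∈ w.support, ∀ y ∈ w.support, G.Adj x y → s(x, y) ∈ w.edges) ∧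
    ∀ e : G.edgeSet, e ∈ S ↔ (e : Sym2 V) ∈ w.edges

section Boundary

variable {K ι : Type*} [Field K] [Fintype ι]

lemma mem_vsupp {c : ι → K} {i : ι} : i ∈ vsupp c ↔ c i ≠ 0 := by
  simp [vsupp]

lemma vsupp_smul {c : ι → K} {t : K} (ht : t ≠ 0) : vsupp (t • c) = vsupp c := by
  ext i
  simp [mem_vsupp, ht]

variable [DecidableEq ι]

/-- The boundary of `c` homogenised with respect to a finset containing the support of `c`. -/
lemma sum_prod_erase_eq_otgen {c : ι → K} {S : Finset ι} (h : vsupp c ⊆ S) :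
    ∑ j ∈ S, (C (c j) * ∏ l ∈ S.erase j, X l : MvPolynomial ι K) =
      (∏ l ∈ S \ vsupp c, X l) * otgen c := by
  rw [otgen, Finset.mul_sum]
  symm
  refine Finset.sum_subset_zero_on_sdiff h ?_ ?_
  · intro j hj
    have : c j = 0 := by
      simpa [mem_vsupp] using (Finset.mem_sdiff.1 hj).2
    simp [this]
  · intro j hj
    have hS : S.erase j = (S \ vsupp c) ∪ (vsupp c).erase j := by
      ext l
      have := @h l
      simp only [Finset.mem_erase, Finset.mem_union, Finset.mem_sdiff]
      constructor
      · tauto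
      · rintro (⟨h1, h2⟩ | ⟨h1, h2⟩)
        · exact ⟨fun hl => h2 (hl ▸ hj), h1⟩
        · exact ⟨h1, this h2⟩
    have hd : Disjoint (S \ vsupp c) ((vsupp c).erase j) :=
      Finset.disjoint_of_subset_right (Finset.erase_subset _ _) Finset.sdiff_disjoint
    rw [hS, Finset.prod_union hd]
    ring

lemma prod_mul_otgen_add {a b : ι → K} {S : Finset ι} (ha : vsupp a ⊆ S) (hb : vsupp b ⊆ S) :
    (∏ l ∈ S \ vsupp (a + b), X l) * otgen (a + b) =
      (∏ l ∈ S \ vsupp a, X l) * otgen a + (∏ l ∈ S \ vsupp b, X l) * otgen b := by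
  have hab : vsupp (a + b) ⊆ S := by
    intro i hi
    by_contra hiS
    have h1 : a i = 0 := by
      by_contra h
      exact hiS (ha (mem_vsupp.2 h))
    have h2 : b i = 0 := by
      by_contra h
      exact hiS (hb (mem_vsupp.2 h))
    exact mem_vsupp.1 hi (by simp [h1, h2])
  rw [← sum_prod_erase_eq_otgen hab, ← sum_prod_erase_eq_otgen ha,
    ← sum_prod_erase_eq_otgen hb, ← Finset.sum_add_distrib]
  refine Finset.sum_congr rfl fun j _ => ?_
  simp [add_mul]

lemma otgen_add_mem {J : Ideal (MvPolynomial ι K)} {a b : ι → K}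
    (ha : vsupp a ⊆ vsupp (a + b)) (hb : vsupp b ⊆ vsupp (a + b))
    (haJ : otgen a ∈ J) (hbJ : otgen b ∈ J) : otgen (a + b) ∈ J := by
  have h := prod_mul_otgen_add ha hb
  rw [Finset.sdiff_self, Finset.prod_empty, one_mul] at h
  rw [h]
  exact J.add_mem (J.mul_mem_left _ haJ) (J.mul_mem_left _ hbJ)

lemma otgen_zero : otgen (0 : ι → K) = 0 := by
  simp [otgen, vsupp]

lemma otgen_smul {c : ι → K} {t : K} (ht : t ≠ 0) : otgen (t • c) = C t * otgen c := by
  rw [otgen, vsupp_smul ht, otgen, Finset.mul_sum]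
  refine Finset.sum_congr rfl fun j _ => ?_
  simp [mul_assoc]

lemma vsupp_single {f : ι} {k : K} (hk : k ≠ 0) : vsupp (Pi.single f k : ι → K) = {f} := by
  ext i
  by_cases h : i = f
  · subst h
    simp [mem_vsupp, hk]
  · simp [mem_vsupp, h]

lemma otgen_single {f : ι} {k : K} (hk : k ≠ 0) : otgen (Pi.single f k : ι → K) = C k := by
  simp [otgen, vsupp_single hk]

lemma vsupp_add_of_disjoint {a b : ι → K} (h : Disjoint (vsupp a) (vsupp b)) :
    vsupp (a + b) = vsupp a ∪ vsupp b := by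
  ext i
  have hi : ¬ (a i ≠ 0 ∧ b i ≠ 0) := fun hi =>
    Finset.disjoint_left.1 h (mem_vsupp.2 hi.1) (mem_vsupp.2 hi.2)
  by_cases h1 : a i = 0 <;> by_cases h2 : b i = 0 <;> simp_all [mem_vsupp]

lemma otgen_add_of_disjoint {a b : ι → K} (h : Disjoint (vsupp a) (vsupp b)) :
    otgen (a + b) = (∏ l ∈ vsupp b, X l) * otgen a + (∏ l ∈ vsupp a, X l) * otgen b := by
  have := prod_mul_otgen_add (Finset.subset_union_left (s₁ := vsupp a) (s₂ := vsupp b))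
    Finset.subset_union_right
  rwa [vsupp_add_of_disjoint h, Finset.sdiff_self, Finset.prod_empty, one_mul,
    Finset.union_sdiff_cancel_left h, Finset.union_sdiff_cancel_right h] at this

/-- If two relations meet exactly in `f`, where their coefficients cancel, then the boundary of
their sum lies in any ideal containing their boundaries. -/
lemma otgen_add_mem_of_single {J : Ideal (MvPolynomial ι K)} {a b : ι → K} {f : ι} {k : K}
    (hk : k ≠ 0) (hab : Disjoint (vsupp a) (vsupp b)) (haf : a f = 0) (hbf : b f = 0)
    (haJ : otgen (a + Pi.single f k) ∈ J) (hbJ : otgen (b + Pi.single f (-k)) ∈ J) :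
    otgen (a + b) ∈ J := by
  have hk' : -k ≠ 0 := neg_ne_zero.2 hk
  have h1 : Disjoint (vsupp a) (vsupp (Pi.single f k : ι → K)) := by
    simp [vsupp_single hk, mem_vsupp, haf]
  have h2 : Disjoint (vsupp b) (vsupp (Pi.single f (-k) : ι → K)) := by
    simp [vsupp_single hk', mem_vsupp, hbf]
  have key : otgen (a + b) = C k⁻¹ * (otgen b * otgen (a + Pi.single f k) -
      otgen a * otgen (b + Pi.single f (-k))) := by
    have hC : (C k⁻¹ * C k : MvPolynomial ι K) = 1 := by
      rw [← C_mul, inv_mul_cancel₀ hk, C_1]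
    rw [otgen_add_of_disjoint h1, otgen_add_of_disjoint h2, otgen_single hk, otgen_single hk',
      vsupp_single hk, vsupp_single hk', otgen_add_of_disjoint hab, Finset.prod_singleton, C_neg]
    linear_combination (-((∏ l ∈ vsupp b, X l) * otgen a) - (∏ l ∈ vsupp a, X l) * otgen b) * hC
  rw [key]
  exact J.mul_mem_left _ (J.sub_mem (J.mul_mem_left _ haJ) (J.mul_mem_left _ hbJ))

/-- Evaluation of the boundary at the indicator vector of a finset `T`. -/
lemma eval_indicator_otgen (c : ι → K) (T : Finset ι) :
    eval (fun i => if i ∈ T then (1 : K) else 0) (otgen c) =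
      ∑ j ∈ vsupp c, if (vsupp c).erase j ⊆ T then c j else 0 := by
  rw [otgen, map_sum]
  refine Finset.sum_congr rfl fun j _ => ?_
  rw [map_mul, map_prod, eval_C]
  simp only [eval_X]
  split_ifs with h
  · rw [Finset.prod_eq_one fun l hl => if_pos (h hl), mul_one]
  · obtain ⟨l, hl, hlT⟩ := Finset.not_subset.1 h
    rw [Finset.prod_eq_zero hl (if_neg hlT), mul_zero]

end Boundary

section GraphRelations

variable {K : Type*} [Field K] {V : Type*} [DecidableEq V] {G : SimpleGraph V}

lemma graphForm_eq_or {u v : V} (h : G.Adj u v) :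
    graphForm K G ⟨s(u, v), h⟩ = Pi.single u 1 - Pi.single v 1 ∨
      graphForm K G ⟨s(u, v), h⟩ = Pi.single v 1 - Pi.single u 1 := by
  have hq : s((Quot.out s(u, v)).1, (Quot.out s(u, v)).2) = s(u, v) := Quot.out_eq _
  rw [Sym2.eq_iff] at hq
  unfold graphForm
  rcases hq with ⟨h1, h2⟩ | ⟨h1, h2⟩
  · left
    simp only [h1, h2]
  · right
    simp only [h1, h2]

lemma graphForm_apply_ne_zero_iff {e : G.edgeSet} {x : V} :
    graphForm K G e x ≠ 0 ↔ x ∈ (e : Sym2 V) := by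
  obtain ⟨e, he⟩ := e
  induction e with | _ u v =>
  have huv : u ≠ v := G.ne_of_adj he
  rw [Sym2.mem_iff]
  rcases graphForm_eq_or (K := K) he with h | h <;> rw [h] <;>
    by_cases h1 : x = u <;> by_cases h2 : x = v <;> simp_all

variable (K) in
/-- The vector supported on the edge `uv` whose image in `K^V` is `z_u - z_v`. -/
noncomputable def adjVec {u v : V} (h : G.Adj u v) : G.edgeSet → K :=
  Pi.single ⟨s(u, v), h⟩ (graphForm K G ⟨s(u, v), h⟩ u)

lemma graphForm_left_ne_zero {u v : V} (h : G.Adj u v) :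
    graphForm K G ⟨s(u, v), h⟩ u ≠ 0 :=
  graphForm_apply_ne_zero_iff.2 (Sym2.mem_mk_left u v)

lemma adjVec_symm {u v : V} (h : G.Adj u v) :
    adjVec K h.symm = Pi.single ⟨s(u, v), h⟩ (-graphForm K G ⟨s(u, v), h⟩ u) := by
  have he : (⟨s(v, u), h.symm⟩ : G.edgeSet) = ⟨s(u, v), h⟩ := Subtype.ext Sym2.eq_swap
  rw [adjVec, he]
  congr 1
  have := h.ne
  have := h.ne'
  rcases graphForm_eq_or (K := K) h with h | h <;> rw [h] <;> simp [*]

variable (K) in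
/-- The signed edge vector of a walk from `u` to `v`; its image in `K^V` is `z_u - z_v`. -/
noncomputable def walkVec : ∀ {u v : V}, G.Walk u v → G.edgeSet → K
  | _, _, .nil => 0
  | _, _, .cons h p => adjVec K h + walkVec p

lemma walkVec_append {u v x : V} (p : G.Walk u v) (q : G.Walk v x) :
    walkVec K (p.append q) = walkVec K p + walkVec K q := by
  induction p with
  | nil => simp [walkVec]
  | cons h p ih => rw [SimpleGraph.Walk.cons_append, walkVec, ih, walkVec, add_assoc]

lemma walkVec_apply_eq_zero {u v : V} {p : G.Walk u v} {e : G.edgeSet}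
    (he : (e : Sym2 V) ∉ p.edges) : walkVec K p e = 0 := by
  induction p with
  | nil => simp [walkVec]
  | cons h p ih =>
    rw [SimpleGraph.Walk.edges_cons, List.mem_cons, not_or] at he
    rw [walkVec, Pi.add_apply, ih he.2, adjVec,
      Pi.single_eq_of_ne fun h' => he.1 (congrArg Subtype.val h'), add_zero]

variable [Fintype V] [DecidableRel G.Adj]

lemma mem_graphRelSpace {c : G.edgeSet → K} :
    c ∈ graphRelSpace K G ↔ ∀ x, ∑ e, c e * graphForm K G e x = 0 := by
  rw [graphRelSpace, LinearMap.mem_ker, funext_iff]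
  simp [graphEvalMap, Finset.sum_apply]

/-- No vertex has degree one in the support of a relation. -/
lemma exists_ne_mem_vsupp {c : G.edgeSet → K} (hc : c ∈ graphRelSpace K G) {e : G.edgeSet}
    (he : e ∈ vsupp c) {x : V} (hx : x ∈ (e : Sym2 V)) :
    ∃ e' ∈ vsupp c, e' ≠ e ∧ x ∈ (e' : Sym2 V) := by
  by_contra! hcon
  have h := mem_graphRelSpace.1 hc x
  rw [Finset.sum_eq_single e] at h
  · exact (mul_ne_zero (mem_vsupp.1 he) (graphForm_apply_ne_zero_iff.2 hx)) h
  · intro e' _ hne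
    by_cases h0 : c e' = 0
    · rw [h0, zero_mul]
    · have := hcon e' (mem_vsupp.2 h0) hne
      rw [← graphForm_apply_ne_zero_iff (K := K), not_not] at this
      rw [this, mul_zero]
  · simp

lemma three_le_card_vsupp {c : G.edgeSet → K} (hc : c ∈ graphRelSpace K G) {e : G.edgeSet}
    (he : e ∈ vsupp c) : 3 ≤ (vsupp c).card := by
  obtain ⟨s, hs⟩ := e
  induction s with | _ u v =>
  obtain ⟨e₁, h₁, hne₁, hm₁⟩ := exists_ne_mem_vsupp hc he (Sym2.mem_mk_left u v)
  obtain ⟨e₂, h₂, hne₂, hm₂⟩ := exists_ne_mem_vsupp hc he (Sym2.mem_mk_right u v)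
  have h12 : e₁ ≠ e₂ := by
    rintro rfl
    exact hne₁ (Subtype.ext ((Sym2.mem_and_mem_iff (G.ne_of_adj hs)).1 ⟨hm₁, hm₂⟩))
  exact Finset.two_lt_card.2 ⟨_, he, _, h₁, _, h₂, hne₁.symm, hne₂.symm, h12⟩

/-- A relation supported on the edges of a path vanishes. -/
lemma eq_zero_of_vsupp_subset_path {u v : V} {p : G.Walk u v} (hp : p.IsPath)
    {c : G.edgeSet → K} (hc : c ∈ graphRelSpace K G)
    (hcp : ∀ e ∈ vsupp c, (e : Sym2 V) ∈ p.edges) : c = 0 := by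
  induction p with
  | nil =>
    funext e
    by_contra h
    simpa using hcp e (mem_vsupp.2 h)
  | @cons a b _ h q ih =>
    rw [SimpleGraph.Walk.cons_isPath_iff] at hp
    refine ih hp.1 fun e he => ?_
    have hmem : ∀ e ∈ vsupp c, (e : Sym2 V) = s(a, b) ∨ (e : Sym2 V) ∈ q.edges := by
      simpa using hcp
    refine (hmem e he).resolve_left fun heq => ?_
    obtain ⟨e', he', hne, hm⟩ := exists_ne_mem_vsupp hc he (heq ▸ Sym2.mem_mk_left _ _)
    rcases hmem e' he' with hq | hq
    · exact hne (Subtype.ext (hq.trans heq.symm))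
    · exact hp.2 (SimpleGraph.Walk.mem_support_of_mem_edges hq hm)

/-- The support of a nonzero relation contains the edges of a cycle. -/
lemma exists_isCycle_edges_subset_vsupp {c : G.edgeSet → K} (hc : c ∈ graphRelSpace K G)
    {e : G.edgeSet} (he : e ∈ vsupp c) :
    ∃ (v : V) (w : G.Walk v v), w.IsCycle ∧
      ∀ e' : G.edgeSet, (e' : Sym2 V) ∈ w.edges → e' ∈ vsupp c := by
  classical
  set H : SimpleGraph V := SimpleGraph.fromEdgeSet (Subtype.val '' (vsupp c : Set G.edgeSet))
    with hH
  have hadj : ∀ (x y : V) (h : G.Adj x y), H.Adj x y ↔ (⟨s(x, y), h⟩ : G.edgeSet) ∈ vsupp c := by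
    intro x y h
    simp [hH, h.ne, h]
  have hle : H ≤ G := by
    intro x y hxy
    simp only [hH, SimpleGraph.fromEdgeSet_adj, Set.mem_image] at hxy
    obtain ⟨⟨e', -, h⟩, -⟩ := hxy
    have := e'.2
    rwa [h] at this
  obtain ⟨s, hs⟩ := e
  induction s with | _ a b =>
  have hHab : H.Adj a b := (hadj a b hs).2 he
  have hreach : (H.deleteEdges {s(a, b)}).Reachable a b := by
    by_contra hnr
    set φ : V → K := fun x => if (H.deleteEdges {s(a, b)}).Reachable a x then 1 else 0 with hφ
    have hsum : ∑ e, c e * ∑ x, φ x * graphForm K G e x = 0 := by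
      have h0 : ∑ x, φ x * ∑ e, c e * graphForm K G e x = 0 :=
        Finset.sum_eq_zero fun x _ => by rw [mem_graphRelSpace.1 hc x, mul_zero]
      rw [← h0]
      simp only [Finset.mul_sum]
      rw [Finset.sum_comm]
      exact Finset.sum_congr rfl fun _ _ => Finset.sum_congr rfl fun _ _ => by ring
    have hpair : ∀ (x y : V) (h : G.Adj x y),
        ∑ z, φ z * graphForm K G ⟨s(x, y), h⟩ z = φ x - φ y ∨
          ∑ z, φ z * graphForm K G ⟨s(x, y), h⟩ z = φ y - φ x := by
      intro x y h
      rcases graphForm_eq_or (K := K) h with h | h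
      · left
        simp [h, mul_sub, Finset.sum_sub_distrib, Pi.single_apply]
      · right
        simp [h, mul_sub, Finset.sum_sub_distrib, Pi.single_apply]
    rw [Finset.sum_eq_single ⟨s(a, b), hs⟩] at hsum
    · have ha : φ a = 1 := if_pos (SimpleGraph.Reachable.refl _)
      have hb : φ b = 0 := if_neg hnr
      have hce := mem_vsupp.1 he
      rcases hpair a b hs with h | h <;> rw [h, ha, hb] at hsum <;> simp [hce] at hsum
    · rintro ⟨s, hs'⟩ - hne
      induction s with | _ x y =>
      by_cases h0 : c ⟨s(x, y), hs'⟩ = 0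
      · rw [h0, zero_mul]
      · have hxy : (H.deleteEdges {s(a, b)}).Adj x y := by
          rw [SimpleGraph.deleteEdges_adj]
          exact ⟨(hadj x y hs').2 (mem_vsupp.2 h0), fun h => hne (Subtype.ext h)⟩
        have hxy' : φ x = φ y := by
          have : (H.deleteEdges {s(a, b)}).Reachable a x ↔
              (H.deleteEdges {s(a, b)}).Reachable a y :=
            ⟨fun h => h.trans hxy.reachable, fun h => h.trans hxy.symm.reachable⟩
          simp only [hφ, this]
        rcases hpair x y hs' with h | h <;> rw [h, hxy', sub_self, mul_zero]
    · simp
  obtain ⟨v, w, hw, -⟩ :=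
    SimpleGraph.adj_and_reachable_delete_edges_iff_exists_cycle.1 ⟨hHab, hreach⟩
  refine ⟨v, w.mapLe hle, hw.mapLe hle, ?_⟩
  rintro ⟨s, hs'⟩ he'
  rw [SimpleGraph.Walk.edges_mapLe_eq_edges] at he'
  induction s with | _ x y =>
  exact (hadj x y hs').1 (w.adj_of_mem_edges he')

lemma graphEvalMap_adjVec {u v : V} (h : G.Adj u v) :
    graphEvalMap K G (adjVec K h) = Pi.single u 1 - Pi.single v 1 := by
  have h1 : graphEvalMap K G (adjVec K h) =
      graphForm K G ⟨s(u, v), h⟩ u • graphForm K G ⟨s(u, v), h⟩ := by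
    simp only [graphEvalMap, adjVec, LinearMap.coe_mk, AddHom.coe_mk]
    rw [Finset.sum_eq_single ⟨s(u, v), h⟩]
    · simp
    · intro e _ he
      simp [he]
    · simp
  rw [h1]
  have := h.ne
  have := h.ne'
  rcases graphForm_eq_or (K := K) h with h | h <;> rw [h] <;> simp [*]

lemma graphEvalMap_walkVec {u v : V} (p : G.Walk u v) :
    graphEvalMap K G (walkVec K p) = Pi.single u 1 - Pi.single v 1 := by
  induction p with
  | nil => simp [walkVec]
  | cons h p ih => rw [walkVec, map_add, ih, graphEvalMap_adjVec, sub_add_sub_cancel]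

lemma walkVec_mem_graphRelSpace {v : V} (w : G.Walk v v) : walkVec K w ∈ graphRelSpace K G := by
  rw [graphRelSpace, LinearMap.mem_ker, graphEvalMap_walkVec, sub_self]

lemma mem_vsupp_walkVec {u v : V} {p : G.Walk u v} (hp : p.IsTrail) {e : G.edgeSet} :
    e ∈ vsupp (walkVec K p) ↔ (e : Sym2 V) ∈ p.edges := by
  rw [mem_vsupp]
  refine ⟨fun h => by_contra fun h' => h (walkVec_apply_eq_zero h'), ?_⟩
  induction p with
  | nil => simp
  | @cons a b _ h p ih =>
    rw [SimpleGraph.Walk.isTrail_cons] at hp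
    rw [SimpleGraph.Walk.edges_cons, List.mem_cons, walkVec, Pi.add_apply, adjVec]
    by_cases heq : (e : Sym2 V) = s(a, b)
    · intro _
      obtain rfl : e = ⟨s(a, b), h⟩ := Subtype.ext heq
      rw [walkVec_apply_eq_zero hp.2, Pi.single_eq_same, add_zero]
      exact graphForm_left_ne_zero h
    · intro he
      rw [Pi.single_eq_of_ne fun h' => heq (congrArg Subtype.val h'), zero_add]
      exact ih hp.1 (he.resolve_left heq)

/-- A relation supported on the edges of a cycle is a multiple of the relation of the cycle. -/
lemma eq_smul_walkVec_of_isCycle {v : V} {w : G.Walk v v} (hw : w.IsCycle)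
    {c : G.edgeSet → K} (hc : c ∈ graphRelSpace K G)
    (hcw : ∀ e ∈ vsupp c, (e : Sym2 V) ∈ w.edges) : ∃ t : K, c = t • walkVec K w := by
  have htrail := hw.isTrail
  have hrel := walkVec_mem_graphRelSpace (K := K) w
  cases w with
  | nil => simp at hw
  | cons h p =>
    set r := walkVec K (SimpleGraph.Walk.cons h p) with hr
    set f : G.edgeSet := ⟨s(_, _), h⟩ with hf
    have hrf : r f ≠ 0 := mem_vsupp.1 ((mem_vsupp_walkVec htrail).2 (by simp [hf]))
    refine ⟨c f / r f, sub_eq_zero.1 ?_⟩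
    refine eq_zero_of_vsupp_subset_path ((SimpleGraph.Walk.cons_isCycle_iff p h).1 hw).1
      (Submodule.sub_mem _ hc (Submodule.smul_mem _ _ hrel)) fun e he => ?_
    have hef : e ≠ f := by
      rintro rfl
      exact mem_vsupp.1 he (by simp [hrf])
    have hmem : (e : Sym2 V) ∈ (SimpleGraph.Walk.cons h p).edges := by
      by_contra hnot
      have h1 : c e = 0 := by
        by_contra h0
        exact hnot (hcw e (mem_vsupp.2 h0))
      have h2 : r e = 0 := walkVec_apply_eq_zero hnot
      exact mem_vsupp.1 he (by simp [h1, h2])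
    rw [SimpleGraph.Walk.edges_cons, List.mem_cons] at hmem
    exact hmem.resolve_left fun h' => hef (Subtype.ext h')

lemma mem_edges_iff_mem_vsupp_of_isCycle {v : V} {w : G.Walk v v} (hw : w.IsCycle)
    {c : G.edgeSet → K} (hc : c ∈ graphRelSpace K G) (hc0 : c ≠ 0)
    (hcw : ∀ e ∈ vsupp c, (e : Sym2 V) ∈ w.edges) (e : G.edgeSet) :
    e ∈ vsupp c ↔ (e : Sym2 V) ∈ w.edges := by
  obtain ⟨t, rfl⟩ := eq_smul_walkVec_of_isCycle hw hc hcw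
  rw [vsupp_smul (by rintro rfl; simp at hc0), mem_vsupp_walkVec hw.isTrail]

/-- A chord splits a cycle into two smaller cycles; if the boundaries of all relations with smaller
support lie in an ideal, then so does the boundary of the relation of the cycle. -/
lemma otgen_mem_of_chord {J : Ideal (MvPolynomial G.edgeSet K)} {x : V} {w : G.Walk x x}
    (hw : w.IsCycle) {y : V} (hy : y ∈ w.support) (hxy : G.Adj x y) (hchord : s(x, y) ∉ w.edges)
    (hJ : ∀ r ∈ graphRelSpace K G, (vsupp r).card < (vsupp (walkVec K w)).card → otgen r ∈ J) :
    otgen (walkVec K w) ∈ J := by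
  set p := w.takeUntil y hy with hp
  set q := w.dropUntil y hy with hq
  have hpq : w = p.append q := (w.take_spec hy).symm
  have hwe : w.edges = p.edges ++ q.edges := by
    rw [hpq, SimpleGraph.Walk.edges_append]
  rw [hwe, List.mem_append, not_or] at hchord
  have hpt : p.IsTrail := hw.isTrail.takeUntil hy
  have hqt : q.IsTrail := hw.isTrail.dropUntil hy
  have hdis : Disjoint (vsupp (walkVec K p)) (vsupp (walkVec K q)) := by
    rw [Finset.disjoint_left]
    intro e h1 h2
    rw [mem_vsupp_walkVec hpt] at h1
    rw [mem_vsupp_walkVec hqt] at h2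
    exact hw.isTrail.disjoint_edges_takeUntil_dropUntil hy h1 h2
  set f : G.edgeSet := ⟨s(x, y), hxy⟩ with hf
  have hpf : walkVec K p f = 0 := walkVec_apply_eq_zero hchord.1
  have hqf : walkVec K q f = 0 := walkVec_apply_eq_zero hchord.2
  set k := graphForm K G f x with hk
  have hk0 : k ≠ 0 := graphForm_left_ne_zero hxy
  have hk0' : -k ≠ 0 := neg_ne_zero.2 hk0
  have hr₁ : walkVec K p + Pi.single f (-k) ∈ graphRelSpace K G := by
    have := walkVec_mem_graphRelSpace (K := K) (.cons hxy.symm p)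
    rwa [walkVec, adjVec_symm, add_comm] at this
  have hr₂ : walkVec K q + Pi.single f k ∈ graphRelSpace K G := by
    have := walkVec_mem_graphRelSpace (K := K) (.cons hxy q)
    rwa [walkVec, adjVec, add_comm] at this
  have card_add : ∀ (a : G.edgeSet → K) (l : K), l ≠ 0 → a f = 0 →
      (vsupp (a + Pi.single f l)).card = (vsupp a).card + 1 ∧ f ∈ vsupp (a + Pi.single f l) := by
    intro a l hl ha
    have hd : Disjoint (vsupp a) (vsupp (Pi.single f l : G.edgeSet → K)) := by
      simp [vsupp_single hl, mem_vsupp, ha]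
    rw [vsupp_add_of_disjoint hd, Finset.card_union_of_disjoint hd, vsupp_single hl]
    simp
  have hc₁ := card_add _ _ hk0' hpf
  have hc₂ := card_add _ _ hk0 hqf
  have h₁ := three_le_card_vsupp hr₁ hc₁.2
  have h₂ := three_le_card_vsupp hr₂ hc₂.2
  have hw' : walkVec K w = walkVec K p + walkVec K q := by
    rw [← walkVec_append, ← hpq]
  rw [hw'] at hJ ⊢
  rw [vsupp_add_of_disjoint hdis, Finset.card_union_of_disjoint hdis] at hJ
  refine otgen_add_mem_of_single hk0' hdis hpf hqf (hJ _ hr₁ (by omega)) ?_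
  rw [neg_neg]
  exact hJ _ hr₂ (by omega)

/-- An ideal containing the boundaries of all chordless cycles contains the boundary of every
relation. -/
lemma otgen_mem_of_chordless {J : Ideal (MvPolynomial G.edgeSet K)}
    (hJ : ∀ c ∈ graphRelSpace K G, c ≠ 0 → IsChordlessCycleEdges G (vsupp c) → otgen c ∈ J)
    {c : G.edgeSet → K} (hc : c ∈ graphRelSpace K G) : otgen c ∈ J := by
  induction hn : (vsupp c).card using Nat.strong_induction_on generalizing c with
  | _ n ih =>
  subst hn
  by_cases hc0 : c = 0
  · rw [hc0, otgen_zero]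
    exact J.zero_mem
  obtain ⟨e, he⟩ := Function.ne_iff.1 hc0
  obtain ⟨v, w, hw, hwc⟩ := exists_isCycle_edges_subset_vsupp hc (mem_vsupp.2 he)
  have hrel := walkVec_mem_graphRelSpace (K := K) w
  by_cases hcw : ∀ e ∈ vsupp c, (e : Sym2 V) ∈ w.edges
  · have hiff := mem_edges_iff_mem_vsupp_of_isCycle hw hc hc0 hcw
    by_cases hch : ∀ x ∈ w.support, ∀ y ∈ w.support, G.Adj x y → s(x, y) ∈ w.edges
    · exact hJ c hc hc0 ⟨v, w, hw, hch, hiff⟩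
    · push Not at hch
      obtain ⟨x, hx, y, hy, hxy, hnot⟩ := hch
      have hedges : ∀ s : Sym2 V, s ∈ (w.rotate x hx).edges ↔ s ∈ w.edges := fun s =>
        (w.rotate_edges x hx).mem_iff
      have hw' : (w.rotate x hx).IsCycle := hw.rotate hx
      obtain ⟨t, ht⟩ := eq_smul_walkVec_of_isCycle hw' hc
        fun e he => (hedges e).2 (hcw e he)
      have ht0 : t ≠ 0 := by
        rintro rfl
        exact hc0 (by rw [ht, zero_smul])
      have hcard : (vsupp (walkVec K (w.rotate x hx))).card = (vsupp c).card := by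
        rw [ht, vsupp_smul ht0]
      rw [ht, otgen_smul ht0]
      refine J.mul_mem_left _ (otgen_mem_of_chord hw' ?_ hxy (fun h => hnot ((hedges _).1 h)) ?_)
      · simpa using hy
      · intro r hr hlt
        exact ih _ (hcard ▸ hlt) hr rfl
  · push Not at hcw
    obtain ⟨g, hg, hgw⟩ := hcw
    set r := walkVec K w with hr
    have hrw : ∀ {e : G.edgeSet}, e ∈ vsupp r ↔ (e : Sym2 V) ∈ w.edges :=
      mem_vsupp_walkVec hw.isTrail
    have hsub : vsupp r ⊆ vsupp c := fun e he => hwc e (hrw.1 he)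
    obtain ⟨f, hf⟩ : ∃ f, f ∈ vsupp r := by
      cases w with
      | nil => simp at hw
      | cons h p => exact ⟨⟨s(_, _), h⟩, hrw.2 (by simp)⟩
    have hcf := mem_vsupp.1 (hsub hf)
    have hrf := mem_vsupp.1 hf
    have ht0 : c f / r f ≠ 0 := div_ne_zero hcf hrf
    have hsub' : vsupp (c - (c f / r f) • r) ⊆ vsupp c := by
      intro e he
      by_contra h
      have hre : r e = 0 := by
        by_contra h0
        exact h (hsub (mem_vsupp.2 h0))
      have hce : c e = 0 := by simpa [mem_vsupp] using h
      exact mem_vsupp.1 he (by simp [hre, hce])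
    have hlt₁ : (vsupp (c - (c f / r f) • r)).card < (vsupp c).card :=
      Finset.card_lt_card ⟨hsub', fun h => mem_vsupp.1 (h (hsub hf)) (by simp [hrf])⟩
    have hlt₂ : (vsupp ((c f / r f) • r)).card < (vsupp c).card := by
      rw [vsupp_smul ht0]
      exact Finset.card_lt_card ⟨hsub, fun h => hgw (hrw.1 (h hg))⟩
    have hrel' := Submodule.smul_mem (graphRelSpace K G) (c f / r f) hrel
    have hsum : c - (c f / r f) • r + (c f / r f) • r = c := sub_add_cancel _ _
    rw [← hsum]
    refine otgen_add_mem ?_ ?_ (ih _ hlt₁ (Submodule.sub_mem _ hc hrel') rfl)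
      (ih _ hlt₂ hrel' rfl)
    · rwa [hsum]
    · rwa [hsum, vsupp_smul ht0]

/-- A relation whose support has all but at most one of its edges in a chordless cycle is supported
on that cycle. -/
lemma mem_of_erase_subset_chordless {S : Finset G.edgeSet} (hS : IsChordlessCycleEdges G S)
    {c : G.edgeSet → K} (hc : c ∈ graphRelSpace K G) {i : G.edgeSet} (hi : i ∈ vsupp c)
    (hsub : (vsupp c).erase i ⊆ S) : i ∈ S := by
  obtain ⟨v, w, -, hch, hSw⟩ := hS
  have hmem : ∀ x ∈ (i : Sym2 V), x ∈ w.support := by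
    intro x hx
    obtain ⟨e, he, hne, hxe⟩ := exists_ne_mem_vsupp hc hi hx
    exact SimpleGraph.Walk.mem_support_of_mem_edges
      ((hSw e).1 (hsub (Finset.mem_erase.2 ⟨hne, he⟩))) hxe
  obtain ⟨s, hs⟩ := i
  induction s with | _ x y =>
  exact (hSw _).2 (hch x (hmem x (Sym2.mem_mk_left x y)) y (hmem y (Sym2.mem_mk_right x y)) hs)

end GraphRelations

/-- Let `G` be a simple graph and `I_G` the Orlik-Terao ideal of the
graphic arrangement `A_G`.  Then `I_G` is minimally generated by the elements `∂(r_C)` as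
`C` ranges over the chordless cycles of `G`: these elements generate `I_G`, and omitting
the generator of any one chordless cycle fails to generate. -/
theorem graphOTIdeal_minimally_generated_by_chordless_cycles
    (K : Type*) [Field K] {V : Type*} [Fintype V] [DecidableEq V]
    (G : SimpleGraph V) [DecidableRel G.Adj] :
    graphOTIdeal K G =
      Ideal.span {g : MvPolynomial G.edgeSet K | ∃ c : G.edgeSet → K,
        c ∈ graphRelSpace K G ∧ c ≠ 0 ∧ IsChordlessCycleEdges G (vsupp c) ∧ g = otgen c} ∧
    ∀ c : G.edgeSet → K, c ∈ graphRelSpace K G → c ≠ 0 →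
      IsChordlessCycleEdges G (vsupp c) →
      otgen c ∉
        Ideal.span {g : MvPolynomial G.edgeSet K | ∃ c' : G.edgeSet → K,
          c' ∈ graphRelSpace K G ∧ c' ≠ 0 ∧ IsChordlessCycleEdges G (vsupp c') ∧
          vsupp c' ≠ vsupp c ∧ g = otgen c'} := by
  refine ⟨le_antisymm ?_ ?_, ?_⟩
  · rw [graphOTIdeal, Ideal.span_le]
    rintro _ ⟨c, hc, rfl⟩
    refine otgen_mem_of_chordless (fun c hc h0 hch => Ideal.subset_span ?_) hc
    exact ⟨c, hc, h0, hch, rfl⟩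
  · refine Ideal.span_mono ?_
    rintro _ ⟨c, hc, -, -, rfl⟩
    exact ⟨c, hc, rfl⟩
  · intro c hc hc0 hch hmem
    obtain ⟨j, hj⟩ := Function.ne_iff.1 hc0
    have hj' : j ∈ vsupp c := mem_vsupp.2 hj
    set T := (vsupp c).erase j with hT
    set φ := eval (fun i => if i ∈ T then (1 : K) else 0) with hφ
    have hker : otgen c ∈ RingHom.ker φ := by
      refine (Ideal.span_le.2 ?_) hmem
      rintro _ ⟨c', hc', hc0', -, hne, rfl⟩
      rw [SetLike.mem_coe, RingHom.mem_ker, hφ, eval_indicator_otgen]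
      refine Finset.sum_eq_zero fun i hi => if_neg fun hsub => hne ?_
      have hsub' : (vsupp c').erase i ⊆ vsupp c := hsub.trans (Finset.erase_subset _ _)
      have hic := mem_of_erase_subset_chordless hch hc' hi hsub'
      obtain ⟨v, w, hw, -, hcw⟩ := hch
      ext e
      rw [hcw e]
      refine mem_edges_iff_mem_vsupp_of_isCycle hw hc' hc0' (fun e he => (hcw e).1 ?_) e
      by_cases hei : e = i
      · exact hei ▸ hic
      · exact hsub' (Finset.mem_erase.2 ⟨hei, he⟩)
    rw [RingHom.mem_ker, hφ, eval_indicator_otgen, Finset.sum_eq_single j] at hker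
    · rw [if_pos (Finset.Subset.refl _)] at hker
      exact hj hker
    · intro i hi hij
      refine if_neg fun hsub => ?_
      exact Finset.notMem_erase j (vsupp c) (hsub (Finset.mem_erase.2 ⟨hij.symm, hj'⟩))
    · exact fun h => absurd hj' h
end

section
/- Let G = K_4 be the complete graph on vertices {1,2,3,4}, with edge variables y_1 = y_{12}, y_2 = y_{13}, y_3 = y_{14}, y_4 = y_{23}, y_5 = y_{24}, y_6 = y_{34}, so that the Orlik–Terao ideal I of A_{K_4} is generated by f_1 = y_5 y_6 + y_4 y_5 − y_4 y_6, f_2 = y_3 y_6 + y_2 y_3 − y_2 y_6, f_3 = y_3 y_5 + y_1 y_3 − y_1 y_5, f_4 = y_2 y_4 + y_1 y_2 − y_1 y_4. Then the following two linearly independent linear syzygies hold: (y_1 − y_2) f_1 − (y_1 + y_5) f_2 + (y_2 + y_6) f_3 − (y_6 − y_5) f_4 = 0 and (y_2 − y_3) f_1 − (y_4 − y_5) f_2 + (y_4 − y_2) f_3 − (y_5 − y_3) f_4 = 0, and they are minimal first syzygies on I. More generally, every induced K_4 subgraph of a simple graph G yields two minimal linear first syzygies on I_G. -/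
open MvPolynomial

/-- The linear combination map `(v_1,…,v_m) ↦ Σ v_i f_i`; its kernel is the syzygy module
of the family `f`. -/
noncomputable def lcMap {R : Type*} [CommRing R] {m : ℕ} (f : Fin m → R) :
    (Fin m → R) →ₗ[R] R where
  toFun v := ∑ i, v i * f i
  map_add' x y := by
    simp [add_mul, Finset.sum_add_distrib]
  map_smul' t x := by
    simp [smul_eq_mul, mul_assoc, Finset.mul_sum]

open MvPolynomial

section Minimality

variable {K σ : Type*} [Field K]

/-- A form of degree `n` that lies in a higher power of the irrelevant ideal vanishes. -/
lemma MvPolynomial.IsHomogeneous.eq_zero_of_mem_pow_idealOfVars {n k : ℕ} {p : MvPolynomial σ K}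
    (hp : p.IsHomogeneous n) (hmem : p ∈ idealOfVars σ K ^ k) (hnk : n < k) : p = 0 := by
  rw [mem_pow_idealOfVars_iff'] at hmem
  ext d
  by_cases hd : d.degree = n
  · simpa using hmem d (hd ▸ hnk)
  · simpa using hp.coeff_eq_zero hd

lemma MvPolynomial.sub_C_constantCoeff_mem_idealOfVars (p : MvPolynomial σ K) :
    p - C (constantCoeff p) ∈ idealOfVars σ K := by
  rw [← pow_one (idealOfVars σ K), mem_pow_idealOfVars_iff']
  intro d hd
  obtain rfl : d = 0 := (Finsupp.degree_eq_zero_iff d).1 (Nat.lt_one_iff.1 hd)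
  simp [constantCoeff_eq]

lemma MvPolynomial.IsHomogeneous.mem_pow_idealOfVars {n : ℕ} {p : MvPolynomial σ K}
    (hp : p.IsHomogeneous n) : p ∈ idealOfVars σ K ^ n := by
  rw [mem_pow_idealOfVars_iff']
  intro d hd
  exact hp.coeff_eq_zero hd.ne

/-- Syzygies on linearly independent forms of the same degree have entries in the
irrelevant ideal. -/
lemma mem_idealOfVars_of_mem_ker_lcMap {m n : ℕ} {F : Fin m → MvPolynomial σ K}
    (hF : ∀ i, (F i).IsHomogeneous n) (hli : LinearIndependent K F)
    {w : Fin m → MvPolynomial σ K} (hw : w ∈ LinearMap.ker (lcMap F)) (i : Fin m) :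
    w i ∈ idealOfVars σ K := by
  have hw' : ∑ i, w i * F i = 0 := hw
  have hsum : ∑ i, C (constantCoeff (w i)) * F i = 0 := by
    refine IsHomogeneous.eq_zero_of_mem_pow_idealOfVars (n := n) (k := n + 1) ?_ ?_ n.lt_succ_self
    · refine IsHomogeneous.sum _ _ _ fun i _ => ?_
      simpa using (isHomogeneous_C σ (constantCoeff (w i))).mul (hF i)
    · have h : ∑ i, C (constantCoeff (w i)) * F i
          = -∑ i, (w i - C (constantCoeff (w i))) * F i := by
        simp [sub_mul, Finset.sum_sub_distrib, hw']
      rw [h, pow_succ']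
      exact neg_mem (sum_mem fun i _ => Ideal.mul_mem_mul
        (sub_C_constantCoeff_mem_idealOfVars _) (hF i).mem_pow_idealOfVars)
  have hzero := Fintype.linearIndependent_iff.1 hli (fun i => constantCoeff (w i))
    (by simpa [smul_eq_C_mul] using hsum) i
  simpa [hzero] using sub_C_constantCoeff_mem_idealOfVars (w i)

/-- Linearly independent linear syzygies on linearly independent forms of the same degree are
minimal. -/
lemma eq_zero_of_linear_syzygy_mem_smul_ker {m n : ℕ} {F : Fin m → MvPolynomial σ K}
    (hF : ∀ i, (F i).IsHomogeneous n) (hli : LinearIndependent K F)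
    {L : Fin 2 → Fin m → MvPolynomial σ K} (hL : ∀ k i, (L k i).IsHomogeneous 1)
    (hLli : LinearIndependent K L) (a b : K)
    (hmem : (fun i => C a * L 0 i + C b * L 1 i) ∈
      (Ideal.span (Set.range (X : σ → MvPolynomial σ K)) • LinearMap.ker (lcMap F) :
        Submodule (MvPolynomial σ K) (Fin m → MvPolynomial σ K))) :
    a = 0 ∧ b = 0 := by
  have hsq : ∀ w ∈ (Ideal.span (Set.range (X : σ → MvPolynomial σ K)) • LinearMap.ker (lcMap F) :
      Submodule (MvPolynomial σ K) (Fin m → MvPolynomial σ K)),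
      ∀ i, w i ∈ idealOfVars σ K ^ 2 := by
    intro w hw
    refine Submodule.smul_induction_on hw (fun r hr u hu i => ?_)
      (fun u u' hu hu' i => add_mem (hu i) (hu' i))
    rw [pow_two]
    exact Ideal.mul_mem_mul hr (mem_idealOfVars_of_mem_ker_lcMap hF hli hu i)
  have hzero : a • L 0 + b • L 1 = 0 := by
    funext i
    refine IsHomogeneous.eq_zero_of_mem_pow_idealOfVars (n := 1) (k := 2) ?_ ?_ one_lt_two
    · exact Submodule.add_mem (homogeneousSubmodule σ K 1)
        (Submodule.smul_mem _ a (hL 0 i)) (Submodule.smul_mem _ b (hL 1 i))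
    · simpa [smul_eq_C_mul] using hsq _ hmem i
  have hcoef := Fintype.linearIndependent_iff.1 hLli ![a, b]
    (by simpa [Fin.sum_univ_two] using hzero)
  exact ⟨hcoef 0, hcoef 1⟩

end Minimality

section Model

variable {K : Type*} [Field K]

/-- The edges `{i,j}` of the triangle of `K_4` omitting the vertex `m`, with the edges of `K_4`
in the order `12, 13, 14, 23, 24, 34`. -/
def k4Triangle : Fin 4 → Fin 3 → Fin 6 :=
  ![![3, 4, 5], ![1, 2, 5], ![0, 2, 4], ![0, 1, 3]]

/-- The smaller endpoint of each edge of `K_4`. -/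
def k4Source : Fin 6 → Fin 4 := ![0, 0, 0, 1, 1, 2]

/-- The larger endpoint of each edge of `K_4`. -/
def k4Target : Fin 6 → Fin 4 := ![1, 2, 3, 2, 3, 3]

variable (K) in
/-- The Orlik-Terao quadrics of the four triangles of `K_4`. -/
noncomputable def k4Quadric : Fin 4 → MvPolynomial (Fin 6) K :=
  ![X 4 * X 5 + X 3 * X 4 - X 3 * X 5,
    X 2 * X 5 + X 1 * X 2 - X 1 * X 5,
    X 2 * X 4 + X 0 * X 2 - X 0 * X 4,
    X 1 * X 3 + X 0 * X 1 - X 0 * X 3]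

variable (K) in
/-- Two linear syzygies on the Orlik-Terao quadrics of `K_4`. -/
noncomputable def k4Syzygy : Fin 2 → Fin 4 → MvPolynomial (Fin 6) K :=
  ![![X 0 - X 1, -(X 0 + X 4), X 1 + X 5, -(X 5 - X 4)],
    ![X 1 - X 2, -(X 3 - X 4), X 3 - X 1, -(X 4 - X 2)]]

lemma k4Triangle_ne (m : Fin 4) : k4Triangle m 0 ≠ k4Triangle m 1 ∧
    k4Triangle m 0 ≠ k4Triangle m 2 ∧ k4Triangle m 1 ≠ k4Triangle m 2 := by
  revert m; decide

lemma k4Source_ne_k4Target (e : Fin 6) : k4Source e ≠ k4Target e := by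
  revert e; decide

lemma injective_k4Edge : Function.Injective fun e => s(k4Source e, k4Target e) := by
  unfold Function.Injective
  decide

/-- The edges of the triangle omitting `m` are `pq`, `pr`, `qr` for suitable `p`, `q`, `r`. -/
lemma k4Triangle_endpoints (m : Fin 4) :
    k4Source (k4Triangle m 1) = k4Source (k4Triangle m 0) ∧
    k4Source (k4Triangle m 2) = k4Target (k4Triangle m 0) ∧
    k4Target (k4Triangle m 2) = k4Target (k4Triangle m 1) := by
  revert m; decide

/-- The edges of the triangle omitting `m` are those not containing `m`. -/
lemma exists_eq_k4Edge_of_ne {m i j : Fin 4} (hi : i ≠ m) (hj : j ≠ m) (hij : i ≠ j) :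
    ∃ k, s(i, j) = s(k4Source (k4Triangle m k), k4Target (k4Triangle m k)) := by
  revert m i j; decide

lemma k4Edge_ne (m : Fin 4) (k : Fin 3) :
    k4Source (k4Triangle m k) ≠ m ∧ k4Target (k4Triangle m k) ≠ m := by
  revert m k; decide

lemma k4Quadric_eq (m : Fin 4) :
    k4Quadric K m = X (k4Triangle m 1) * X (k4Triangle m 2)
      + X (k4Triangle m 0) * X (k4Triangle m 1) - X (k4Triangle m 0) * X (k4Triangle m 2) := by
  fin_cases m <;> rfl

lemma k4Quadric_isHomogeneous (m : Fin 4) : (k4Quadric K m).IsHomogeneous 2 := by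
  rw [k4Quadric_eq]
  exact (((isHomogeneous_X K _).mul (isHomogeneous_X K _)).add
    ((isHomogeneous_X K _).mul (isHomogeneous_X K _))).sub
    ((isHomogeneous_X K _).mul (isHomogeneous_X K _))

lemma k4Syzygy_isHomogeneous (k : Fin 2) (m : Fin 4) : (k4Syzygy K k m).IsHomogeneous 1 := by
  have hsub (i j : Fin 6) : (X i - X j : MvPolynomial (Fin 6) K).IsHomogeneous 1 :=
    (isHomogeneous_X K i).sub (isHomogeneous_X K j)
  have hadd (i j : Fin 6) : (X i + X j : MvPolynomial (Fin 6) K).IsHomogeneous 1 :=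
    (isHomogeneous_X K i).add (isHomogeneous_X K j)
  fin_cases k <;> fin_cases m
  exacts [hsub 0 1, (hadd 0 4).neg, hadd 1 5, (hsub 5 4).neg,
    hsub 1 2, (hsub 3 4).neg, hsub 3 1, (hsub 4 2).neg]

lemma sum_k4Syzygy_mul_k4Quadric (k : Fin 2) : ∑ m, k4Syzygy K k m * k4Quadric K m = 0 := by
  fin_cases k <;> simp [Fin.sum_univ_four, k4Syzygy, k4Quadric] <;> ring

lemma linearIndependent_k4Quadric : LinearIndependent K (k4Quadric K) := by
  rw [Fintype.linearIndependent_iff]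
  intro a ha
  have h (x : Fin 6 → K) := congrArg (MvPolynomial.eval x) ha
  have h0 := h ![0, 0, 0, 0, 1, 1]
  have h1 := h ![0, 0, 1, 0, 0, 1]
  have h2 := h ![0, 0, 1, 0, 1, 0]
  have h3 := h ![0, 1, 0, 1, 0, 0]
  simp [Fin.sum_univ_four, k4Quadric, smul_eval] at h0 h1 h2 h3
  intro i
  fin_cases i <;> assumption

lemma linearIndependent_k4Syzygy : LinearIndependent K (k4Syzygy K) := by
  rw [Fintype.linearIndependent_iff]
  intro a ha
  have h (x : Fin 6 → K) := congrArg (MvPolynomial.eval x) (congrFun ha 0)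
  have h0 := h ![1, 0, 0, 0, 0, 0]
  have h1 := h ![0, 0, 1, 0, 0, 0]
  simp [Fin.sum_univ_two, k4Syzygy, smul_eval] at h0 h1
  intro i
  fin_cases i <;> assumption

end Model

section OTIdeal

variable {K ι : Type*} [Field K] [Fintype ι] [DecidableEq ι]

lemma otgen_eq_sum_ite (c : ι → K) [DecidablePred fun l => c l = 0] :
    otgen c = ∑ j, C (c j) * ∏ l, if l = j ∨ c l = 0 then 1 else X l := by
  have hne (j : ι) : j ∈ vsupp c ↔ c j ≠ 0 := by simp [vsupp]
  rw [otgen, ← Finset.sum_subset (Finset.subset_univ (vsupp c))]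
  · refine Finset.sum_congr rfl fun j _ => ?_
    congr 1
    rw [← Finset.prod_subset (Finset.subset_univ ((vsupp c).erase j))]
    · refine Finset.prod_congr rfl fun l hl => ?_
      rw [Finset.mem_erase, hne] at hl
      simp [hl.1, hl.2]
    · intro l _ hl
      rw [Finset.mem_erase, hne] at hl
      have : l = j ∨ c l = 0 := by tauto
      simp [this]
  · intro j _ hj
    rw [hne, not_not] at hj
    simp [hj]

lemma otgen_of_vsupp_eq_triple {c : ι → K} {a b d : ι} (hab : a ≠ b) (had : a ≠ d) (hbd : b ≠ d)
    (hc : vsupp c = {a, b, d}) :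
    otgen c = C (c a) * (X b * X d) + C (c b) * (X a * X d) + C (c d) * (X a * X b) := by
  have ha : ({a, b, d} : Finset ι).erase a = {b, d} := by ext; simp; grind
  have hb : ({a, b, d} : Finset ι).erase b = {a, d} := by ext; simp; grind
  have hd : ({a, b, d} : Finset ι).erase d = {a, b} := by ext; simp; grind
  rw [otgen, hc, Finset.sum_insert (by simp [hab, had]), Finset.sum_insert (by simp [hbd]),
    Finset.sum_singleton, ha, hb, hd, Finset.prod_pair hbd, Finset.prod_pair had,
    Finset.prod_pair hab, add_assoc]

lemma otgen_single_sub_single_add_single {a b d : ι} (hab : a ≠ b) (had : a ≠ d) (hbd : b ≠ d) :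
    otgen (Pi.single a 1 - Pi.single b 1 + Pi.single d 1 : ι → K)
      = X b * X d + X a * X b - X a * X d := by
  have hsupp : vsupp (Pi.single a 1 - Pi.single b 1 + Pi.single d 1 : ι → K) = {a, b, d} := by
    ext j
    simp only [vsupp, Finset.mem_filter, Finset.mem_univ, true_and, Pi.add_apply, Pi.sub_apply,
      Pi.single_apply, Finset.mem_insert, Finset.mem_singleton]
    grind
  rw [otgen_of_vsupp_eq_triple hab had hbd hsupp]
  simp [hab, had, hbd, hab.symm, had.symm, hbd.symm]
  ring

set_option maxHeartbeats 1000000 in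
/-- The boundary of every relation of `K_4` lies in any ideal containing the four triangle
quadrics. -/
lemma otgen_mem_of_k4Quadric_mem {I : Ideal (MvPolynomial (Fin 6) K)}
    (hI : ∀ m, k4Quadric K m ∈ I) {c : Fin 6 → K} (h0 : c 0 + c 1 + c 2 = 0)
    (h1 : c 3 + c 4 = c 0) (h2 : c 5 = c 1 + c 3) : otgen c ∈ I := by
  classical
  have mem (r : Fin 4 → MvPolynomial (Fin 6) K) (h : otgen c = ∑ m, r m * k4Quadric K m) :
      otgen c ∈ I := h ▸ sum_mem fun m _ => I.mul_mem_left _ (hI m)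
  have e2 : C (σ := Fin 6) (c 2) = - C (c 1) - C (c 0) := by
    rw [← map_neg, ← map_sub]; congr 1; linear_combination h0
  have e4 : C (σ := Fin 6) (c 4) = C (c 0) - C (c 3) := by
    rw [← map_sub]; congr 1; linear_combination h1
  have e5 : C (σ := Fin 6) (c 5) = C (c 1) + C (c 3) := by
    rw [h2, map_add]
  have expand := otgen_eq_sum_ite c
  simp only [Fin.sum_univ_six, Fin.prod_univ_six] at expand
  by_cases z0 : c 0 = 0
  · by_cases z3 : c 3 = 0
    · by_cases z1 : c 1 = 0
      · have z4 : c 4 = 0 := by grind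
        have z2 : c 2 = 0 := by grind
        have z5 : c 5 = 0 := by grind
        simp [expand, z0, z1, z2, z3, z4, z5]
      · have z4 : c 4 = 0 := by grind
        have z2 : c 2 ≠ 0 := by grind
        have z5 : c 5 ≠ 0 := by grind
        refine mem ![0, C (c 1), 0, 0] ?_
        simp [expand, z0, z1, z2, z3, z4, z5, Fin.sum_univ_four, k4Quadric] at e2 e4 e5 ⊢
        grind
    · by_cases z1 : c 1 = 0
      · have z4 : c 4 ≠ 0 := by grind
        have z2 : c 2 = 0 := by grind
        have z5 : c 5 ≠ 0 := by grind
        refine mem ![C (c 3), 0, 0, 0] ?_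
        simp [expand, z0, z1, z2, z3, z4, z5, Fin.sum_univ_four, k4Quadric] at e2 e4 e5 ⊢
        grind
      · have z4 : c 4 ≠ 0 := by grind
        have z2 : c 2 ≠ 0 := by grind
        by_cases z5 : c 5 = 0
        · refine mem ![C (c 3) * (X 1 - X 2), C (c 3) * (X 4 - X 3), 0, 0] ?_
          simp [expand, z0, z1, z2, z3, z4, z5, Fin.sum_univ_four, k4Quadric] at e2 e4 e5 ⊢
          grind
        · refine mem ![C (c 3) * (X 1 * X 2), C (c 1) * (X 3 * X 4), 0, 0] ?_
          simp [expand, z0, z1, z2, z3, z4, z5, Fin.sum_univ_four, k4Quadric] at e2 e4 e5 ⊢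
          grind
  · by_cases z3 : c 3 = 0
    · by_cases z1 : c 1 = 0
      · have z4 : c 4 ≠ 0 := by grind
        have z2 : c 2 ≠ 0 := by grind
        have z5 : c 5 = 0 := by grind
        refine mem ![0, 0, C (c 0), 0] ?_
        simp [expand, z0, z1, z2, z3, z4, z5, Fin.sum_univ_four, k4Quadric] at e2 e4 e5 ⊢
        grind
      · have z4 : c 4 ≠ 0 := by grind
        by_cases z2 : c 2 = 0
        · have z5 : c 5 ≠ 0 := by grind
          refine mem ![0, C (c 1) * (X 0 + X 4), -C (c 1) * (X 1 + X 5), 0] ?_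
          simp [expand, z0, z1, z2, z3, z4, z5, Fin.sum_univ_four, k4Quadric] at e2 e4 e5 ⊢
          grind
        · have z5 : c 5 ≠ 0 := by grind
          refine mem ![0, C (c 1) * (X 0 * X 4), C (c 0) * (X 1 * X 5), 0] ?_
          simp [expand, z0, z1, z2, z3, z4, z5, Fin.sum_univ_four, k4Quadric] at e2 e4 e5 ⊢
          grind
    · by_cases z1 : c 1 = 0
      · by_cases z4 : c 4 = 0
        · have z2 : c 2 ≠ 0 := by grind
          have z5 : c 5 ≠ 0 := by grind
          refine mem ![C (c 0) * (X 0 - X 2), 0, C (c 0) * (X 3 + X 5), 0] ?_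
          simp [expand, z0, z1, z2, z3, z4, z5, Fin.sum_univ_four, k4Quadric] at e2 e4 e5 ⊢
          grind
        · have z2 : c 2 ≠ 0 := by grind
          have z5 : c 5 ≠ 0 := by grind
          refine mem ![C (c 3) * (X 0 * X 2), 0, C (c 0) * (X 3 * X 5), 0] ?_
          simp [expand, z0, z1, z2, z3, z4, z5, Fin.sum_univ_four, k4Quadric] at e2 e4 e5 ⊢
          grind
      · by_cases z4 : c 4 = 0
        · by_cases z2 : c 2 = 0
          · have z5 : c 5 = 0 := by grind
            refine mem ![0, 0, 0, -C (c 1)] ?_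
            simp [expand, z0, z1, z2, z3, z4, z5, Fin.sum_univ_four, k4Quadric] at e2 e4 e5 ⊢
            grind
          · have z5 : c 5 ≠ 0 := by grind
            refine mem ![0, -C (c 2) * (X 0 * X 3), 0, C (c 0) * (X 2 * X 5)] ?_
            simp [expand, z0, z1, z2, z3, z4, z5, Fin.sum_univ_four, k4Quadric] at e2 e4 e5 ⊢
            grind
        · by_cases z2 : c 2 = 0
          · have z5 : c 5 ≠ 0 := by grind
            refine mem ![C (c 5) * (X 0 * X 1), 0, 0, -C (c 1) * (X 4 * X 5)] ?_
            simp [expand, z0, z1, z2, z3, z4, z5, Fin.sum_univ_four, k4Quadric] at e2 e4 e5 ⊢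
            grind
          · by_cases z5 : c 5 = 0
            · refine mem ![0, 0, C (c 4) * (X 1 * X 3), C (c 3) * (X 2 * X 4)] ?_
              simp [expand, z0, z1, z2, z3, z4, z5, Fin.sum_univ_four, k4Quadric] at e2 e4 e5 ⊢
              grind
            · refine mem ![C (c 3) * (X 0 * X 1 * X 2), C (c 1) * (X 0 * X 3 * X 4),
                C (c 0) * (X 1 * X 3 * X 5), 0] ?_
              simp [expand, z0, z1, z2, z3, z4, z5, Fin.sum_univ_four, k4Quadric] at e2 e4 e5 ⊢
              grind

end OTIdeal

section SignedSubstitution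

variable {K σ : Type*} [Field K]

/-- The substitution `X i ↦ s i X (ε i)` of the edge variables of `K_4`. -/
noncomputable def signedSubst (ε : Fin 6 → σ) (s : Fin 6 → K) :
    MvPolynomial (Fin 6) K →ₐ[K] MvPolynomial σ K :=
  aeval fun i => C (s i) * X (ε i)

lemma signedSubst_isHomogeneous (ε : Fin 6 → σ) (s : Fin 6 → K) {n : ℕ}
    {p : MvPolynomial (Fin 6) K} (hp : p.IsHomogeneous n) :
    (signedSubst ε s p).IsHomogeneous n := by
  have := hp.aeval (fun i => C (s i) * X (ε i))
    (fun i => (isHomogeneous_C σ (s i)).mul (isHomogeneous_X K (ε i)))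
  rwa [zero_add, one_mul] at this

lemma signedSubst_injective {ε : Fin 6 → σ} (hε : Function.Injective ε) {s : Fin 6 → K}
    (hs : ∀ i, s i * s i = 1) : Function.Injective (signedSubst ε s) := by
  let ρ : MvPolynomial σ K →ₐ[K] MvPolynomial (Fin 6) K :=
    aeval (Function.extend ε (fun i => C (s i) * X i) 0)
  have hρ : ρ.comp (signedSubst ε s) = AlgHom.id K _ := by
    refine algHom_ext fun i => ?_
    simp only [AlgHom.comp_apply, signedSubst, aeval_X, map_mul, ρ, hε.extend_apply,
      AlgHom.id_apply, algHom_C, algebraMap_eq]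
    rw [← mul_assoc, ← C_mul, hs, C_1, one_mul]
  exact Function.LeftInverse.injective (g := ρ) fun p => DFunLike.congr_fun hρ p

end SignedSubstitution

section Graph

variable {K : Type*} [Field K] {V : Type*} [DecidableEq V] {G : SimpleGraph V}

lemma exists_graphForm_eq_sign_smul {p q : V} (h : s(p, q) ∈ G.edgeSet) :
    ∃ s : K, s * s = 1 ∧
      graphForm K G ⟨s(p, q), h⟩ = s • (Pi.single p (1 : K) - Pi.single q (1 : K)) := by
  have hout : s((Quot.out s(p, q)).1, (Quot.out s(p, q)).2) = s(p, q) := Quot.out_eq _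
  rcases Sym2.eq_iff.1 hout with ⟨hp, hq⟩ | ⟨hp, hq⟩
  · exact ⟨1, by simp, by simp only [graphForm, hp, hq, one_smul]⟩
  · exact ⟨-1, by simp, by simp only [graphForm, hp, hq, neg_smul, one_smul, neg_sub]⟩

variable [Fintype V] [DecidableRel G.Adj]

/-- A relation supported on a triangle `p q r` is a multiple of the cycle relation, so its
boundary is a multiple of the corresponding quadric. -/
lemma exists_otgen_eq_of_vsupp_eq_triangle {c : G.edgeSet → K} (hc : c ∈ graphRelSpace K G)
    {a b d : G.edgeSet} (hab : a ≠ b) (had : a ≠ d) (hbd : b ≠ d) (hsupp : vsupp c = {a, b, d})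
    {p q r : V} (hpq : p ≠ q) (hpr : p ≠ r) (hqr : q ≠ r) {sa sb sd : K}
    (hsb : sb * sb = 1) (hsd : sd * sd = 1)
    (ha : graphForm K G a = sa • (Pi.single p (1 : K) - Pi.single q (1 : K)))
    (hb : graphForm K G b = sb • (Pi.single p (1 : K) - Pi.single r (1 : K)))
    (hd : graphForm K G d = sd • (Pi.single q (1 : K) - Pi.single r (1 : K))) :
    ∃ μ : K, μ ≠ 0 ∧ otgen c = C μ * ((C sb * X b) * (C sd * X d)
      + (C sa * X a) * (C sb * X b) - (C sa * X a) * (C sd * X d)) := by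
  have hmem (e : G.edgeSet) : e ∈ vsupp c ↔ c e ≠ 0 := by simp [vsupp]
  have hca : c a ≠ 0 := by rw [← hmem, hsupp]; simp
  have hrel : c a • graphForm K G a + (c b • graphForm K G b + c d • graphForm K G d) = 0 := by
    have h0 : ∑ e, c e • graphForm K G e = 0 := hc
    rw [← Finset.sum_subset (Finset.subset_univ (vsupp c)), hsupp,
      Finset.sum_insert (by simp [hab, had]), Finset.sum_insert (by simp [hbd]),
      Finset.sum_singleton] at h0
    · exact h0
    · intro e _ he
      rw [hmem, not_not] at he
      simp [he]
  rw [ha, hb, hd] at hrel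
  have hp := congrFun hrel p
  have hq := congrFun hrel q
  simp [hpq, hpr, hqr, hpq.symm] at hp hq
  have hcb : c b = -(sb * (c a * sa)) := by linear_combination sb * hp - c b * hsb
  have hcd : c d = sd * (c a * sa) := by linear_combination sd * hq - c d * hsd
  have hsb0 : sb ≠ 0 := left_ne_zero_of_mul_eq_one hsb
  have hsd0 : sd ≠ 0 := left_ne_zero_of_mul_eq_one hsd
  refine ⟨c a * (sb * sd), mul_ne_zero hca (mul_ne_zero hsb0 hsd0), ?_⟩
  have Cb := congrArg (C (σ := G.edgeSet)) hsb
  have Cd := congrArg (C (σ := G.edgeSet)) hsd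
  simp only [C_mul, C_1] at Cb Cd
  rw [otgen_of_vsupp_eq_triple hab had hbd hsupp, hcb, hcd]
  simp only [C_mul, C_neg]
  linear_combination C (c a) * X b * X d * (-(C sd * C sd) * Cb - Cd)
    + C sb * C (c a) * C sa * X a * X d * Cd - C sd * C (c a) * C sa * X a * X b * Cb

/-- An embedded `K_4` yields two minimal linear syzygies on the boundaries of relations supported on
its four triangles. -/
lemma exists_minimal_linear_syzygies {φ : Fin 4 ↪ V}
    (hφ : ∀ i j, i ≠ j → G.Adj (φ i) (φ j)) (g : Fin 4 → (G.edgeSet → K))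
    (hg : ∀ m, g m ∈ graphRelSpace K G ∧ g m ≠ 0 ∧
      ∀ e : G.edgeSet, e ∈ vsupp (g m) ↔
        ∃ i j : Fin 4, i ≠ m ∧ j ≠ m ∧ i ≠ j ∧ (e : Sym2 V) = s(φ i, φ j)) :
    ∃ L : Fin 2 → Fin 4 → MvPolynomial G.edgeSet K,
      (∀ k m, (L k m).IsHomogeneous 1) ∧
      (∀ k, ∑ m, L k m * otgen (g m) = 0) ∧
      ∀ a b : K,
        (fun m => C a * L 0 m + C b * L 1 m) ∈
          (Ideal.span (Set.range (X : G.edgeSet → MvPolynomial G.edgeSet K)) •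
            LinearMap.ker (lcMap fun m => otgen (g m)) :
            Submodule (MvPolynomial G.edgeSet K) (Fin 4 → MvPolynomial G.edgeSet K)) →
        a = 0 ∧ b = 0 := by
  have hadj (e : Fin 6) : s(φ (k4Source e), φ (k4Target e)) ∈ G.edgeSet :=
    hφ _ _ (k4Source_ne_k4Target e)
  let ε (e : Fin 6) : G.edgeSet := ⟨s(φ (k4Source e), φ (k4Target e)), hadj e⟩
  have hε : Function.Injective ε := fun e e' h =>
    injective_k4Edge (Sym2.map.injective φ.injective (congrArg Subtype.val h))
  choose s hs hform using fun e => exists_graphForm_eq_sign_smul (K := K) (hadj e)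
  have hsupp (m : Fin 4) :
      vsupp (g m) = {ε (k4Triangle m 0), ε (k4Triangle m 1), ε (k4Triangle m 2)} := by
    have hmem (k : Fin 3) : ε (k4Triangle m k) ∈ vsupp (g m) :=
      ((hg m).2.2 _).2 ⟨_, _, (k4Edge_ne m k).1, (k4Edge_ne m k).2, k4Source_ne_k4Target _, rfl⟩
    ext e
    constructor
    · intro he
      obtain ⟨i, j, hi, hj, hij, heq⟩ := ((hg m).2.2 e).1 he
      obtain ⟨k, hk⟩ := exists_eq_k4Edge_of_ne hi hj hij
      obtain rfl : e = ε (k4Triangle m k) :=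
        Subtype.ext (heq.trans (congrArg (Sym2.map φ) hk))
      fin_cases k <;> simp
    · simp only [Finset.mem_insert, Finset.mem_singleton]
      rintro (rfl | rfl | rfl) <;> exact hmem _
  have hquad (m : Fin 4) : ∃ μ : K, μ ≠ 0 ∧
      otgen (g m) = C μ * signedSubst ε s (k4Quadric K m) := by
    obtain ⟨h01, h02, h12⟩ := k4Triangle_ne m
    obtain ⟨h1, h2, h3⟩ := k4Triangle_endpoints m
    have hb := hform (k4Triangle m 1)
    have hd := hform (k4Triangle m 2)
    obtain ⟨μ, hμ, h⟩ := exists_otgen_eq_of_vsupp_eq_triangle (hg m).1 (hε.ne h01) (hε.ne h02)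
      (hε.ne h12) (hsupp m) (φ.injective.ne (k4Source_ne_k4Target _))
      (φ.injective.ne (h1 ▸ k4Source_ne_k4Target _))
      (φ.injective.ne (h2 ▸ h3 ▸ k4Source_ne_k4Target _)) (hs _) (hs _)
      (hform (k4Triangle m 0)) (hb.trans (by rw [h1]))
      (hd.trans (by rw [h2, h3]))
    refine ⟨μ, hμ, ?_⟩
    rw [h, k4Quadric_eq]
    simp only [signedSubst, map_add, map_sub, map_mul, aeval_X]
  choose μ hμ hotgen using hquad
  have hinj := signedSubst_injective hε hs
  let L (k : Fin 2) (m : Fin 4) : MvPolynomial G.edgeSet K :=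
    C (μ m)⁻¹ * signedSubst ε s (k4Syzygy K k m)
  have hLhom (k : Fin 2) (m : Fin 4) : (L k m).IsHomogeneous 1 := by
    simpa using (isHomogeneous_C _ (μ m)⁻¹).mul
      (signedSubst_isHomogeneous ε s (k4Syzygy_isHomogeneous k m))
  have hFhom (m : Fin 4) : (otgen (g m)).IsHomogeneous 2 := by
    rw [hotgen]
    simpa using (isHomogeneous_C _ (μ m)).mul
      (signedSubst_isHomogeneous ε s (k4Quadric_isHomogeneous m))
  have hC (m : Fin 4) : (C (μ m)⁻¹ * C (μ m) : MvPolynomial G.edgeSet K) = 1 := by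
    rw [← C_mul, inv_mul_cancel₀ (hμ m), C_1]
  have hFli : LinearIndependent K fun m => otgen (g m) := by
    have h := ((linearIndependent_k4Quadric (K := K)).map_injOn (signedSubst ε s).toLinearMap
      hinj.injOn).units_smul fun m => Units.mk0 (μ m) (hμ m)
    have heq : (fun m => otgen (g m)) = (fun m => Units.mk0 (μ m) (hμ m)) •
        (signedSubst ε s).toLinearMap ∘ k4Quadric K := by
      funext m
      rw [hotgen, ← smul_eq_C_mul]
      rfl
    rwa [heq]
  have hLli : LinearIndependent K L := by
    rw [Fintype.linearIndependent_iff]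
    intro a ha
    refine Fintype.linearIndependent_iff.1 (linearIndependent_k4Syzygy (K := K)) a
      (funext fun m => hinj ?_)
    have hm : C (μ m) * (∑ k, a k • L k) m = 0 := by rw [ha]; simp
    rw [Finset.sum_apply, Finset.mul_sum] at hm
    rw [Finset.sum_apply, map_sum, Pi.zero_apply, map_zero, ← hm]
    refine Finset.sum_congr rfl fun k _ => ?_
    simp only [Pi.smul_apply, smul_eq_C_mul, map_mul, algHom_C, algebraMap_eq, L]
    linear_combination (-(C (a k) * signedSubst ε s (k4Syzygy K k m))) * hC m
  refine ⟨L, hLhom, fun k => ?_, eq_zero_of_linear_syzygy_mem_smul_ker hFhom hFli hLhom hLli⟩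
  rw [← map_zero (signedSubst ε s), ← sum_k4Syzygy_mul_k4Quadric k, map_sum]
  refine Finset.sum_congr rfl fun m _ => ?_
  rw [hotgen, map_mul]
  linear_combination (signedSubst ε s (k4Syzygy K k m) * signedSubst ε s (k4Quadric K m)) * hC m

end Graph

/-- For `G = K_4` on vertices `{1,2,3,4}`, with edge variables
`y_1 = y_{12}, y_2 = y_{13}, y_3 = y_{14}, y_4 = y_{23}, y_5 = y_{24}, y_6 = y_{34}`
(below `X 0, …, X 5`), the Orlik-Terao ideal `I` of `A_{K_4}` is generated by
`f_1 = y_5y_6 + y_4y_5 − y_4y_6`, `f_2 = y_3y_6 + y_2y_3 − y_2y_6`,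
`f_3 = y_3y_5 + y_1y_3 − y_1y_5`, `f_4 = y_2y_4 + y_1y_2 − y_1y_4`; the two linear syzygies
`(y_1−y_2)f_1 − (y_1+y_5)f_2 + (y_2+y_6)f_3 − (y_6−y_5)f_4 = 0` and
`(y_2−y_3)f_1 − (y_4−y_5)f_2 + (y_4−y_2)f_3 − (y_5−y_3)f_4 = 0` hold; the two syzygy vectors
are linearly independent; and they are minimal first syzygies on `I` (their images in
`Syz/m·Syz`, `m` the irrelevant ideal, are linearly independent over `K`).  More generally,
every induced `K_4` subgraph of a simple graph `G` yields two such minimal linear first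
syzygies on the quadrics of `I_G` associated with its four triangles. -/
theorem k4_two_minimal_linear_syzygies
    (K : Type*) [Field K]
    -- `A` is the (essentialized) graphic arrangement of `K_4`, with the forms of the six
    -- hyperplanes `z_i − z_j = 0` listed in the order `y_12, y_13, y_14, y_23, y_24, y_34`
    (A : CentralArrangement K (Fin 6) 3)
    (hA : A.form = ![![1, -1, 0], ![1, 0, -1], ![1, 0, 0],
                     ![0, 1, -1], ![0, 1, 0], ![0, 0, 1]])
    (f : Fin 4 → MvPolynomial (Fin 6) K)
    (hf : f = ![X 4 * X 5 + X 3 * X 4 - X 3 * X 5,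
                X 2 * X 5 + X 1 * X 2 - X 1 * X 5,
                X 2 * X 4 + X 0 * X 2 - X 0 * X 4,
                X 1 * X 3 + X 0 * X 1 - X 0 * X 3])
    (v : Fin 2 → Fin 4 → MvPolynomial (Fin 6) K)
    (hv : v = ![![X 0 - X 1, -(X 0 + X 4), X 1 + X 5, -(X 5 - X 4)],
                ![X 1 - X 2, -(X 3 - X 4), X 3 - X 1, -(X 4 - X 2)]]) :
    -- the `f i` generate the Orlik-Terao ideal of `A_{K_4}`
    A.otIdeal = Ideal.span (Set.range f) ∧
    -- the two linear syzygies hold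
    (∀ k, ∑ i, v k i * f i = 0) ∧
    -- they are linearly independent
    LinearIndependent K v ∧
    -- and minimal: their images in `Syz/m·Syz` are `K`-linearly independent
    (∀ a b : K,
      (fun i => C a * v 0 i + C b * v 1 i) ∈
        (Ideal.span (Set.range (X : Fin 6 → MvPolynomial (Fin 6) K)) •
          LinearMap.ker (lcMap f) : Submodule (MvPolynomial (Fin 6) K) (Fin 4 → MvPolynomial (Fin 6) K)) →
      a = 0 ∧ b = 0) ∧
    -- more generally, every induced `K_4` subgraph of a simple graph `G` yields two
    -- minimal linear first syzygies on the four triangle quadrics of `I_G`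
    (∀ (V : Type) (_ : Fintype V) (_ : DecidableEq V) (G : SimpleGraph V)
        (_ : DecidableRel G.Adj) (φ : Fin 4 ↪ V),
      (∀ i j, i ≠ j → G.Adj (φ i) (φ j)) →
      ∀ g : Fin 4 → (G.edgeSet → K),
        (∀ m, g m ∈ graphRelSpace K G ∧ g m ≠ 0 ∧
          ∀ e : G.edgeSet, e ∈ vsupp (g m) ↔
            ∃ i j : Fin 4, i ≠ m ∧ j ≠ m ∧ i ≠ j ∧ (e : Sym2 V) = s(φ i, φ j)) →
        ∃ L : Fin 2 → Fin 4 → MvPolynomial G.edgeSet K,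
          (∀ k m, (L k m).IsHomogeneous 1) ∧
          (∀ k, ∑ m, L k m * otgen (g m) = 0) ∧
          ∀ a b : K,
            (fun m => C a * L 0 m + C b * L 1 m) ∈
              (Ideal.span (Set.range (X : G.edgeSet → MvPolynomial G.edgeSet K)) •
                LinearMap.ker (lcMap fun m => otgen (g m)) :
                Submodule (MvPolynomial G.edgeSet K) (Fin 4 → MvPolynomial G.edgeSet K)) →
            a = 0 ∧ b = 0) := by
  obtain rfl : f = k4Quadric K := hf
  obtain rfl : v = k4Syzygy K := hv
  refine ⟨le_antisymm ?_ ?_, sum_k4Syzygy_mul_k4Quadric, linearIndependent_k4Syzygy,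
    eq_zero_of_linear_syzygy_mem_smul_ker k4Quadric_isHomogeneous linearIndependent_k4Quadric
      k4Syzygy_isHomogeneous linearIndependent_k4Syzygy, ?_⟩
  · refine Ideal.span_le.2 ?_
    rintro _ ⟨c, hc, rfl⟩
    have hrel : ∑ i, c i • A.form i = 0 := hc
    have h0 := congrFun hrel 0
    have h1 := congrFun hrel 1
    have h2 := congrFun hrel 2
    simp [hA, Fin.sum_univ_six] at h0 h1 h2
    exact otgen_mem_of_k4Quadric_mem (fun m => Ideal.subset_span (Set.mem_range_self m))
      (by grind) (by grind) (by grind)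
  · rw [Ideal.span_le]
    rintro _ ⟨m, rfl⟩
    obtain ⟨h01, h02, h12⟩ := k4Triangle_ne m
    rw [k4Quadric_eq, ← otgen_single_sub_single_add_single h01 h02 h12]
    refine Ideal.subset_span (Set.mem_image_of_mem _ ?_)
    change ∑ i, _ • A.form i = 0
    rw [hA]
    ext j
    fin_cases m <;> fin_cases j <;> simp [Fin.sum_univ_six, k4Triangle, Pi.single_apply]
  · intro V _ _ G _ φ hφ g hg
    exact exists_minimal_linear_syzygies hφ g hg
end
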